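/- arXiv:1304.6703 — 3 statements merged into one kernel-verified Lean document; each statement's English description precedes it below -/
import Mathlib

section
/- Let m ≥ 2 and let h₁,…,h_m be integrable even real functions on ℝ belonging to the class F₁(ℝ) := { f ∈ L¹(ℝ) : ∫_ℝ |t| |f̂(t)| dt < ∞ }. Then Δ_W(T) := | S_W(T) − (2π)^{m−1} ∫_ℝ h₁(λ)⋯h_m(λ) dλ | = O(T^{−1}) as T → ∞. -/
open MeasureTheory Filter Set Asymptotics Real
open scoped ENNReal Topology

noncomputable section

/-- Fourier transform of an integrable function on ℝ. -/
def hatR (h : ℝ → ℝ) (t : ℝ) : ℂ :=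
  ∫ x : ℝ, Complex.exp (Complex.I * x * t) * (h x)

/-- S_W(T) = (1/T)·tr[W_T(h₁)⋯W_T(h_m)], written as the cyclic
multiple integral over [0,T]^m of the product of kernels. -/
def SW (m : ℕ) [NeZero m] (h : Fin m → ℝ → ℝ) (T : ℝ) : ℂ :=
  (T : ℂ)⁻¹ * ∫ u in Set.univ.pi (fun _ : Fin m => Icc (0 : ℝ) T),
    ∏ i : Fin m, hatR (h i) (u i - u (i + 1))

/-- The trace approximation error for Toeplitz operators. -/
def ΔW (m : ℕ) [NeZero m] (h : Fin m → ℝ → ℝ) (T : ℝ) : ℝ :=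
  ‖SW m h T - (((2 * π) ^ (m - 1) * ∫ x : ℝ, ∏ i, h i x : ℝ) : ℂ)‖

/-- The class F₁(ℝ): integrable functions with ∫ |t|·|f̂(t)| dt < ∞. -/
def memF1R (h : ℝ → ℝ) : Prop :=
  Integrable h ∧ Integrable (fun t : ℝ => |t| * ‖hatR h t‖)

lemma norm_exp_aux (x t : ℝ) : ‖Complex.exp (Complex.I * x * t)‖ = 1 := by
  rw [show Complex.I * (x:ℂ) * t = ((x * t : ℝ) : ℂ) * Complex.I by push_cast; ring]
  exact Complex.norm_exp_ofReal_mul_I _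

lemma hatR_cont {h : ℝ → ℝ} (hh : Integrable h) : Continuous (hatR h) := by
  unfold hatR
  refine continuous_of_dominated (bound := fun x => ‖h x‖) ?_ ?_ hh.norm ?_
  · intro t
    exact (Continuous.aestronglyMeasurable (by fun_prop)).mul hh.ofReal.aestronglyMeasurable
  · intro t
    refine Eventually.of_forall fun x => ?_
    rw [norm_mul, norm_exp_aux]; simp
  · refine Eventually.of_forall fun x => ?_
    fun_prop

lemma hatR_bound (h : ℝ → ℝ) (t : ℝ) : ‖hatR h t‖ ≤ ∫ x, ‖h x‖ := by
  unfold hatR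
  refine (norm_integral_le_integral_norm _).trans (le_of_eq ?_)
  congr 1; ext x
  rw [norm_mul, norm_exp_aux]; simp

lemma hatR_integrable {h : ℝ → ℝ} (hh : memF1R h) : Integrable (hatR h) := by
  obtain ⟨h1, h2⟩ := hh
  have h3 : Integrable ((Icc (-1:ℝ) 1).indicator (fun _ => ∫ x, ‖h x‖)) := by
    rw [integrable_indicator_iff measurableSet_Icc]
    exact integrableOn_const (by simp)
  refine (h3.add h2).mono' (hatR_cont h1).aestronglyMeasurable (Eventually.of_forall fun t => ?_)
  simp only [Pi.add_apply]
  by_cases ht : t ∈ Icc (-1:ℝ) 1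
  · rw [indicator_of_mem ht]
    have := hatR_bound h t
    have : 0 ≤ |t| * ‖hatR h t‖ := by positivity
    linarith
  · rw [indicator_of_notMem ht, zero_add]
    have : 1 ≤ |t| := by
      by_contra hc
      exact ht (abs_le.mp (le_of_lt (not_le.mp hc)))
    nlinarith [norm_nonneg (hatR h t)]

lemma hatR_integrable' {h : ℝ → ℝ} (hh : memF1R h) :
    Integrable (fun t => (1 + |t|) * ‖hatR h t‖) := by
  refine ((hatR_integrable hh).norm.add hh.2).congr (Eventually.of_forall fun t => ?_)
  simp only [Pi.add_apply]; ring

open FourierTransform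

lemma fourier_hatR (h : ℝ → ℝ) (w : ℝ) :
    𝓕 (fun x => (h x : ℂ)) w = hatR h (w * (-2 * π)) := by
  rw [Real.fourier_real_eq_integral_exp_smul]
  unfold hatR
  congr 1; ext x
  rw [smul_eq_mul]; congr 2
  push_cast; ring

lemma integral_fourier_adj {f g : ℝ → ℂ} (hf : Integrable f) (hg : Integrable g) :
    ∫ x, 𝓕 f x * g x = ∫ x, f x * 𝓕 g x := by
  have := VectorFourier.integral_fourierIntegral_smul_eq_flip (L := innerₗ ℝ)
      Real.continuous_fourierChar continuous_inner hf hg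
  simpa using! this

lemma integral_fourierInv_adj {f g : ℝ → ℂ} (hf : Integrable f) (hg : Integrable g) :
    ∫ x, 𝓕⁻ f x * g x = ∫ x, f x * 𝓕⁻ g x := by
  calc ∫ x, 𝓕⁻ f x * g x = ∫ x, 𝓕 f (-x) * g (- (- x)) := by
        simp [Real.fourierInv_eq_fourier_neg]
    _ = ∫ x, 𝓕 f x * g (-x) := integral_neg_eq_self (fun x => 𝓕 f x * g (-x)) volume
    _ = ∫ x, f x * 𝓕 (fun x => g (-x)) x := integral_fourier_adj hf hg.comp_neg
    _ = _ := by
        congr 1; ext x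
        rw [Real.fourierInv_eq_fourier_comp_neg]

lemma inversion_ae {f : ℝ → ℂ} (hf : Integrable f) (hF : Integrable (𝓕 f)) :
    ∀ᵐ x, 𝓕⁻ (𝓕 f) x = f x := by
  have hc : Continuous (𝓕⁻ (𝓕 f)) := by
    have : 𝓕⁻ (𝓕 f) = fun x => 𝓕 (𝓕 f) (-x) := by
      ext x; rw [Real.fourierInv_eq_fourier_neg]
    rw [this]
    exact (VectorFourier.fourierIntegral_continuous Real.continuous_fourierChar
      (L := innerₗ ℝ) continuous_inner hF).comp continuous_neg
  refine ae_eq_of_integral_contDiff_smul_eq hc.locallyIntegrable hf.locallyIntegrable ?_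
  intro g hg hgc
  have hgC : ContDiff ℝ (⊤ : ℕ∞) (fun x => (g x : ℂ)) := Complex.ofRealCLM.contDiff.comp hg
  have hgs : HasCompactSupport (fun x => (g x : ℂ)) := hgc.comp_left (g := fun r : ℝ => (r : ℂ)) (by simp)
  let G : SchwartzMap ℝ ℂ := hgs.toSchwartzMap hgC
  have hG : ∀ x, G x = (g x : ℂ) := fun x => rfl
  have e1 : ∀ x, 𝓕 (𝓕⁻ (G : ℝ → ℂ)) x = G x := by
    intro x
    rw [← SchwartzMap.fourierInv_coe, ← SchwartzMap.fourier_coe]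
    simp
  have i1 : Integrable (𝓕⁻ (G : ℝ → ℂ)) := by
    rw [← SchwartzMap.fourierInv_coe]; exact SchwartzMap.integrable _
  calc ∫ x, g x • 𝓕⁻ (𝓕 f) x = ∫ x, 𝓕⁻ (𝓕 f) x * G x := by
        congr 1; ext x; rw [hG, Complex.real_smul, mul_comm]
    _ = ∫ x, 𝓕 f x * 𝓕⁻ (G : ℝ → ℂ) x := integral_fourierInv_adj hF G.integrable
    _ = ∫ x, f x * 𝓕 (𝓕⁻ (G : ℝ → ℂ)) x := integral_fourier_adj hf i1
    _ = ∫ x, g x • f x := by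
        congr 1; ext x; rw [e1, hG, Complex.real_smul, mul_comm]

lemma hatR_inversion {h : ℝ → ℝ} (hh : memF1R h) :
    ∀ᵐ x : ℝ, ∫ v : ℝ, hatR h (-v) * Complex.exp (Complex.I * x * v) = 2 * π * h x := by
  have hpi : (2 * π : ℝ) ≠ 0 := by positivity
  have hF : Integrable (𝓕 (fun x => (h x : ℂ))) := by
    have : 𝓕 (fun x => (h x : ℂ)) = fun w => hatR h (w * (-2 * π)) := by
      ext w; exact fourier_hatR h w
    rw [this]
    exact (hatR_integrable hh).comp_mul_right' (by simpa using Real.pi_ne_zero)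
  filter_upwards [inversion_ae hh.1.ofReal hF] with x hx
  have hx' : 𝓕⁻ (𝓕 (fun x => (h x : ℂ))) x = (h x : ℂ) := hx
  rw [← hx', Real.fourierInv_eq'] 
  have := Measure.integral_comp_mul_right
    (fun v : ℝ => hatR h (-v) * Complex.exp (Complex.I * x * v)) (2 * π)
  have e : ∀ v : ℝ, Complex.exp (((2 * π * inner ℝ v x : ℝ) : ℂ) * Complex.I) • 𝓕 (fun x => (h x : ℂ)) v
     = (fun v : ℝ => hatR h (-v) * Complex.exp (Complex.I * x * v)) (v * (2 * π)) := by
    intro v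
    rw [fourier_hatR, smul_eq_mul, mul_comm]
    simp only []
    congr 2
    · ring
    · simp; ring
  rw [integral_congr_ae (Eventually.of_forall e), this]
  rw [abs_of_pos (by positivity), Complex.real_smul]
  push_cast
  field_simp

/-- The density in difference coordinates. -/
def Pfun (n : ℕ) (h : Fin (n+1) → ℝ → ℝ) (v : Fin n → ℝ) : ℂ :=
  (∏ i : Fin n, hatR (h i.castSucc) (-v i)) * hatR (h (Fin.last n)) (∑ i, v i)

lemma Pfun_cont (n : ℕ) (h : Fin (n+1) → ℝ → ℝ) (hF1 : ∀ i, memF1R (h i)) :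
    Continuous (Pfun n h) := by
  have := fun i => hatR_cont (hF1 i).1
  unfold Pfun
  fun_prop

lemma prod_hat_integrable (n : ℕ) (h : Fin (n+1) → ℝ → ℝ) (hF1 : ∀ i, memF1R (h i)) :
    Integrable (fun v : Fin n → ℝ => ∏ i : Fin n, hatR (h i.castSucc) (-v i)) :=
  Integrable.fintype_prod (f := fun (i : Fin n) t => hatR (h i.castSucc) (-t))
    (fun i => (hatR_integrable (hF1 _)).comp_neg)

lemma Pfun_integral (n : ℕ) (h : Fin (n+1) → ℝ → ℝ) (hF1 : ∀ i, memF1R (h i)) :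
    ∫ v, Pfun n h v = (((2 * π) ^ n * ∫ x : ℝ, ∏ i, h i x : ℝ) : ℂ) := by
  have hint : Integrable (fun z : (Fin n → ℝ) × ℝ =>
      Complex.exp (Complex.I * z.2 * (∑ i, z.1 i : ℝ)) *
      ((∏ i : Fin n, hatR (h i.castSucc) (-z.1 i)) * (h (Fin.last n) z.2 : ℂ)))
      (volume.prod volume) := by
    refine Integrable.bdd_mul (c := 1)
      ((prod_hat_integrable n h hF1).mul_prod (hF1 (Fin.last n)).1.ofReal) ?_ ?_
    · exact Continuous.aestronglyMeasurable (by fun_prop)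
    · exact Eventually.of_forall fun z => (norm_exp_aux _ _).le
  have hae : ∀ᵐ x : ℝ, ∀ i : Fin n,
      ∫ v : ℝ, hatR (h i.castSucc) (-v) * Complex.exp (Complex.I * x * v)
        = 2 * π * h i.castSucc x :=
    ae_all_iff.2 fun i => hatR_inversion (hF1 _)
  calc ∫ v, Pfun n h v
      = ∫ v : Fin n → ℝ, ∫ x : ℝ, Complex.exp (Complex.I * x * (∑ i, v i : ℝ)) *
      ((∏ i : Fin n, hatR (h i.castSucc) (-v i)) * (h (Fin.last n) x : ℂ)) := by
        congr 1; ext v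
        unfold Pfun
        conv_lhs => rw [hatR]
        rw [← integral_const_mul]
        congr 1; ext x; ring
    _ = ∫ x : ℝ, ∫ v : Fin n → ℝ, Complex.exp (Complex.I * x * (∑ i, v i : ℝ)) *
      ((∏ i : Fin n, hatR (h i.castSucc) (-v i)) * (h (Fin.last n) x : ℂ)) :=
        integral_integral_swap hint
    _ = ∫ x : ℝ, ((((2 * π) ^ n * ∏ i, h i x : ℝ)) : ℂ) := by
        refine integral_congr_ae ?_
        filter_upwards [hae] with x hx
        have : ∀ v : Fin n → ℝ, Complex.exp (Complex.I * x * (∑ i, v i : ℝ)) *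
          ((∏ i : Fin n, hatR (h i.castSucc) (-v i)) * (h (Fin.last n) x : ℂ))
          = (∏ i : Fin n, (hatR (h i.castSucc) (-v i) * Complex.exp (Complex.I * x * v i)))
            * (h (Fin.last n) x : ℂ) := by
          intro v
          rw [Finset.prod_mul_distrib, ← Complex.exp_sum, ← Finset.mul_sum]
          push_cast
          ring
        simp_rw [this]
        rw [integral_mul_const]
        have e := integral_fintype_prod_volume_eq_prod (𝕜 := ℂ) (ι := Fin n) (E := fun _ => ℝ)
          (fun i t => hatR (h i.castSucc) (-t) * Complex.exp (Complex.I * x * t))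
        rw [e, Finset.prod_congr rfl (fun i _ => hx i), Finset.prod_mul_distrib,
          Fin.prod_univ_castSucc]
        simp
        ring
    _ = _ := by
        rw [integral_complex_ofReal, integral_const_mul]

lemma abs_sum_bound {n : ℕ} (v : Fin n → ℝ) : ∑ i, |v i| ≤ ∏ i, (1 + |v i|) := by
  have key : ∀ s : Finset (Fin n), 1 + ∑ i ∈ s, |v i| ≤ ∏ i ∈ s, (1 + |v i|) := by
    intro s
    induction s using Finset.induction_on with
    | empty => simp
    | insert a s ha ih =>
      rw [Finset.sum_insert ha, Finset.prod_insert ha]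
      have h0 : 0 ≤ ∑ i ∈ s, |v i| := Finset.sum_nonneg fun i _ => abs_nonneg _
      nlinarith [abs_nonneg (v a), mul_nonneg (abs_nonneg (v a)) h0]
  linarith [key Finset.univ]

/-- Summation matrix. -/
def Nmat (n : ℕ) : Matrix (Fin (n+1)) (Fin (n+1)) ℝ :=
  Matrix.of fun k j => if j ≤ k then 1 else 0

lemma Nmat_det (n : ℕ) : (Nmat n).det = 1 := by
  rw [Matrix.det_of_isLowerTriangular]
  · simp [Nmat]
  · intro i j hij
    have : i < j := by simpa using hij
    simp [Nmat, this]

lemma Nmat_mp (n : ℕ) : MeasurePreserving (Matrix.toLin' (Nmat n)) volume volume := by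
  refine ⟨(LinearMap.continuous_of_finiteDimensional _).measurable, ?_⟩
  rw [Real.map_matrix_volume_pi_eq_smul_volume_pi (by rw [Nmat_det]; norm_num), Nmat_det]
  simp

lemma Nmat_apply (n : ℕ) (b : ℝ) (v : Fin n → ℝ) (k : Fin (n+1)) :
    Matrix.toLin' (Nmat n) (Fin.cons b v) k = b + Fin.partialSum v k := by
  induction k using Fin.induction with
  | zero =>
    simp [Nmat, Matrix.mulVec, dotProduct, Fin.sum_univ_succ]
  | succ i ih =>
    rw [Fin.partialSum_succ, ← add_assoc, ← ih]
    simp only [Matrix.toLin'_apply, Nmat, Matrix.mulVec, dotProduct, Matrix.of_apply]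
    have : v i = ∑ j : Fin (n+1), (if j = i.succ then (1:ℝ) else 0) * (Fin.cons b v : Fin (n+1) → ℝ) j := by
      simp
    rw [this, ← Finset.sum_add_distrib]
    refine Finset.sum_congr rfl fun j _ => ?_
    rw [← add_mul]
    congr 1
    simp only [Fin.le_def, Fin.ext_iff, Fin.val_succ, Fin.val_castSucc]
    split_ifs <;> first | omega | norm_num

lemma partialSum_last {n : ℕ} (v : Fin n → ℝ) : Fin.partialSum v (Fin.last n) = ∑ i, v i := by
  rw [Fin.partialSum, List.take_of_length_le (by simp), List.sum_ofFn]

lemma partialSum_bound {n : ℕ} (v : Fin n → ℝ) (k : Fin (n+1)) :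
    |Fin.partialSum v k| ≤ ∑ i, |v i| := by
  have h1 : |Fin.partialSum v k| ≤ Fin.partialSum (fun i => |v i|) k := by
    induction k using Fin.induction with
    | zero => simp
    | succ i ih =>
      rw [Fin.partialSum_succ, Fin.partialSum_succ]
      exact (abs_add_le _ _).trans (by gcongr)
  have hm : Monotone (Fin.partialSum (fun i => |v i|)) := by
    rw [Fin.monotone_iff_le_succ]
    intro i
    rw [Fin.partialSum_succ]
    linarith [abs_nonneg (v i)]
  refine h1.trans ((hm (Fin.le_last k)).trans (le_of_eq ?_))
  exact partialSum_last _

/-- Set of base points. -/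
def Bset (n : ℕ) (T : ℝ) : Set (ℝ × (Fin n → ℝ)) :=
  {z | ∀ k, z.1 + Fin.partialSum z.2 k ∈ Icc (0:ℝ) T}

lemma partialSum_cont {n : ℕ} (k : Fin (n+1)) :
    Continuous (fun v : Fin n → ℝ => Fin.partialSum v k) := by
  induction k using Fin.induction with
  | zero => simpa using continuous_const
  | succ i ih =>
    simp_rw [Fin.partialSum_succ]
    fun_prop

lemma Bset_meas (n : ℕ) (T : ℝ) : MeasurableSet (Bset n T) := by
  have : Bset n T = ⋂ k, (fun z : ℝ × (Fin n → ℝ) => z.1 + Fin.partialSum z.2 k) ⁻¹' (Icc 0 T) := by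
    ext z; simp [Bset]
  rw [this]
  refine MeasurableSet.iInter fun k => ?_
  have := partialSum_cont k
  exact (Continuous.measurable (by fun_prop)) measurableSet_Icc

lemma integral_coords (n : ℕ) (h : Fin (n+1) → ℝ → ℝ) (T : ℝ) :
    (∫ u in Set.univ.pi (fun _ : Fin (n+1) => Icc (0 : ℝ) T),
      ∏ i : Fin (n+1), hatR (h i) (u i - u (i + 1)))
    = ∫ z : ℝ × (Fin n → ℝ), (Bset n T).indicator (fun z => Pfun n h z.2) z := by
  have hS : MeasurableSet (Set.univ.pi (fun _ : Fin (n+1) => Icc (0 : ℝ) T)) :=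
    MeasurableSet.univ_pi fun _ => measurableSet_Icc
  have hdet : LinearMap.det (Matrix.toLin' (Nmat n)) ≠ 0 := by
    rw [LinearMap.det_toLin', Nmat_det]; norm_num
  have hemb : MeasurableEmbedding (Matrix.toLin' (Nmat n)) :=
    (LinearMap.equivOfDetNeZero _ hdet).toContinuousLinearEquiv.toHomeomorph.measurableEmbedding
  rw [← integral_indicator hS, ← (Nmat_mp n).integral_comp hemb]
  have mp := (volume_preserving_piFinSuccAbove (fun _ : Fin (n+1) => ℝ) 0).symm
  rw [← mp.integral_comp (MeasurableEquiv.measurableEmbedding _)]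
  congr 1
  ext ⟨b, v⟩
  have hc : (MeasurableEquiv.piFinSuccAbove (fun _ : Fin (n+1) => ℝ) 0).symm (b, v) = Fin.cons b v := by
    simp [MeasurableEquiv.piFinSuccAbove]
    rfl
  rw [hc]
  have happ := Nmat_apply n b v
  set u := Matrix.toLin' (Nmat n) (Fin.cons b v) with hu
  have hmem : u ∈ Set.univ.pi (fun _ : Fin (n+1) => Icc (0 : ℝ) T) ↔ (b, v) ∈ Bset n T := by
    simp only [Set.mem_univ_pi, Bset, Set.mem_ofPred_eq, happ]
  have hval : ∏ i : Fin (n+1), hatR (h i) (u i - u (i + 1)) = Pfun n h v := by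
    rw [Fin.prod_univ_castSucc, Pfun]
    congr 1
    · refine Finset.prod_congr rfl fun i _ => ?_
      rw [Fin.coeSucc_eq_succ, happ, happ, Fin.partialSum_succ]
      congr 1; ring
    · rw [Fin.last_add_one, happ, happ, partialSum_last]
      simp
  by_cases hz : (b, v) ∈ Bset n T
  · rw [Set.indicator_of_mem hz, Set.indicator_of_mem (hmem.2 hz)]
    exact hval
  · rw [Set.indicator_of_notMem hz, Set.indicator_of_notMem (fun hh => hz (hmem.1 hh))]

/-- Length of the section of `Bset`. -/
def lam (n : ℕ) (T : ℝ) (v : Fin n → ℝ) : ℝ := volume.real {b : ℝ | (b, v) ∈ Bset n T}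

lemma lam_bound (n : ℕ) {T : ℝ} (hT : 0 ≤ T) (v : Fin n → ℝ) :
    |lam n T v - T| ≤ 2 * ∑ i, |v i| := by
  set S := ∑ i, |v i| with hS
  have h0 : 0 ≤ S := Finset.sum_nonneg fun i _ => abs_nonneg _
  have hsub : {b : ℝ | (b, v) ∈ Bset n T} ⊆ Icc 0 T := by
    intro b hb
    have := hb 0
    simpa using this
  have hsup : Icc S (T - S) ⊆ {b : ℝ | (b, v) ∈ Bset n T} := by
    intro b hb k
    have h1 := abs_le.1 (partialSum_bound v k)
    simp only [Set.mem_Icc] at hb ⊢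
    constructor <;> linarith
  have hup : lam n T v ≤ T := by
    have := measureReal_mono (μ := volume) hsub (by simp)
    simpa [lam, Real.volume_real_Icc, hT] using this
  have hlo : T - 2 * S ≤ lam n T v := by
    have := measureReal_mono (μ := volume) hsup (measure_ne_top_of_subset hsub (by simp))
    rw [Real.volume_real_Icc] at this
    have h2 := le_max_left (T - S - S) 0
    unfold lam
    linarith
  rw [abs_le]; constructor <;> linarith

lemma Pfun_integrable (n : ℕ) (h : Fin (n+1) → ℝ → ℝ) (hF1 : ∀ i, memF1R (h i)) :
    Integrable (Pfun n h) := by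
  refine (prod_hat_integrable n h hF1).mul_bdd (c := ∫ x, ‖h (Fin.last n) x‖) ?_ ?_
  · have := hatR_cont (hF1 (Fin.last n)).1
    exact Continuous.aestronglyMeasurable (by fun_prop)
  · exact Eventually.of_forall fun v => hatR_bound _ _

lemma Pfun_weighted (n : ℕ) (h : Fin (n+1) → ℝ → ℝ) (hF1 : ∀ i, memF1R (h i)) :
    Integrable (fun v => (2 * ∑ i, |v i|) * ‖Pfun n h v‖) := by
  have h1 : Integrable (fun v : Fin n → ℝ =>
      ∏ i : Fin n, ((1 + |v i|) * ‖hatR (h i.castSucc) (-v i)‖)) := by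
    refine Integrable.fintype_prod
      (f := fun (i : Fin n) t => (1 + |t|) * ‖hatR (h i.castSucc) (-t)‖) (fun i => ?_)
    simpa using (hatR_integrable' (hF1 i.castSucc)).comp_neg
  refine (h1.const_mul (2 * ∫ x, ‖h (Fin.last n) x‖)).mono' ?_ (Eventually.of_forall fun v => ?_)
  · have := Pfun_cont n h hF1
    exact Continuous.aestronglyMeasurable (by fun_prop)
  · have h0 : 0 ≤ ∑ i, |v i| := Finset.sum_nonneg fun i _ => abs_nonneg _
    rw [Real.norm_of_nonneg (by positivity), Finset.prod_mul_distrib, Pfun, norm_mul, norm_prod]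
    have hb := hatR_bound (h (Fin.last n)) (∑ i, v i)
    have hs := abs_sum_bound v
    set A := ∏ i : Fin n, ‖hatR (h i.castSucc) (-v i)‖
    have hA : 0 ≤ A := Finset.prod_nonneg fun i _ => norm_nonneg _
    calc (2 * ∑ i, |v i|) * (A * ‖hatR (h (Fin.last n)) (∑ i, v i)‖)
        ≤ 2 * (∏ i, (1 + |v i|)) * (A * ∫ x, ‖h (Fin.last n) x‖) := by gcongr
      _ = _ := by ring

lemma integral_lam (n : ℕ) (h : Fin (n+1) → ℝ → ℝ) (hF1 : ∀ i, memF1R (h i)) (T : ℝ) :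
    Integrable (fun v => (lam n T v : ℂ) * Pfun n h v) ∧
    ∫ z : ℝ × (Fin n → ℝ), (Bset n T).indicator (fun z => Pfun n h z.2) z
      = ∫ v, (lam n T v : ℂ) * Pfun n h v := by
  have hI : Integrable ((Bset n T).indicator (fun z : ℝ × (Fin n → ℝ) => Pfun n h z.2))
      (volume.prod volume) := by
    have h1 : Integrable ((Icc (0:ℝ) T).indicator (fun _ => (1:ℂ))) := by
      rw [integrable_indicator_iff measurableSet_Icc]
      exact integrableOn_const (by simp)
    refine (h1.mul_prod (Pfun_integrable n h hF1)).mono ?_ (Eventually.of_forall ?_)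
    · have := Pfun_cont n h hF1
      exact (Continuous.aestronglyMeasurable (by fun_prop)).indicator (Bset_meas n T)
    · rintro ⟨b, v⟩
      by_cases hz : (b, v) ∈ Bset n T
      · have hb : b ∈ Icc 0 T := by simpa using hz 0
        rw [Set.indicator_of_mem hz]
        simp [Set.indicator_of_mem hb]
      · rw [Set.indicator_of_notMem hz, norm_zero]; exact norm_nonneg _
  have hin : ∀ v : Fin n → ℝ, ∫ b : ℝ, (Bset n T).indicator (fun z => Pfun n h z.2) (b, v)
      = (lam n T v : ℂ) * Pfun n h v := by
    intro v
    have hm : MeasurableSet {b : ℝ | (b, v) ∈ Bset n T} :=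
      (Bset_meas n T).preimage (by fun_prop : Measurable fun b : ℝ => (b, v))
    have : (fun b : ℝ => (Bset n T).indicator (fun z => Pfun n h z.2) (b, v))
      = {b : ℝ | (b, v) ∈ Bset n T}.indicator (fun _ => Pfun n h v) := by
      ext b; rfl
    rw [this, integral_indicator hm, setIntegral_const, lam, Complex.real_smul]
  refine ⟨?_, ?_⟩
  · have := hI.integral_prod_right
    simpa only [hin] using this
  · rw [Measure.volume_eq_prod, integral_prod_symm _ hI]
    simp only [hin]

theorem stmt10 (m : ℕ) [NeZero m] (hm : 2 ≤ m) (h : Fin m → ℝ → ℝ)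
    (heven : ∀ i, ∀ x : ℝ, h i (-x) = h i x)
    (hF1 : ∀ i, memF1R (h i)) :
    (fun T : ℝ => ΔW m h T) =O[atTop] fun T : ℝ => T⁻¹ := by
  obtain ⟨n, rfl⟩ : ∃ n, m = n + 1 := ⟨m - 1, by omega⟩
  refine IsBigO.of_bound (∫ v, (2 * ∑ i, |v i|) * ‖Pfun n h v‖) ?_
  filter_upwards [eventually_gt_atTop 0] with T hT
  obtain ⟨hi, he⟩ := integral_lam n h hF1 T
  have hTC : (T : ℂ) ≠ 0 := by exact_mod_cast hT.ne'
  have key : SW (n+1) h T - (((2 * π) ^ (n + 1 - 1) * ∫ x : ℝ, ∏ i, h i x : ℝ) : ℂ)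
      = (T : ℂ)⁻¹ * ∫ v, ((lam n T v - T : ℝ) : ℂ) * Pfun n h v := by
    rw [Nat.add_sub_cancel, ← Pfun_integral n h hF1]
    have e1 : SW (n+1) h T = (T : ℂ)⁻¹ * ∫ v, (lam n T v : ℂ) * Pfun n h v := by
      rw [← he, ← integral_coords n h T]
      rfl
    have e2 : ∫ v, ((lam n T v - T : ℝ) : ℂ) * Pfun n h v
        = (∫ v, (lam n T v : ℂ) * Pfun n h v) - T * ∫ v, Pfun n h v := by
      rw [← integral_const_mul, ← integral_sub hi ((Pfun_integrable n h hF1).const_mul _)]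
      congr 1; ext v; push_cast; ring
    rw [e1, e2]
    field_simp
  rw [ΔW, key, norm_norm, norm_mul, norm_inv, Complex.norm_real, norm_inv, mul_comm]
  gcongr
  refine (norm_integral_le_integral_norm _).trans ?_
  refine integral_mono_of_nonneg (Eventually.of_forall fun v => norm_nonneg _)
    (Pfun_weighted n h hF1) (Eventually.of_forall fun v => ?_)
  simp only [norm_mul, Complex.norm_real, Real.norm_eq_abs]
  gcongr
  exact lam_bound n hT.le v
end
end

section
/- Let m ≥ 2 and let h₁,…,h_m be integrable even real functions on ℝ. Suppose the function φ(u₁,…,u_{m−1}) := ∫_ℝ h₁(λ) h₂(λ−u₁) ⋯ h_m(λ−u_{m−1}) dλ is (essentially) bounded on ℝ^{m−1} and satisfies |φ(u) − φ(0)| ≤ C·(|u₁| + ⋯ + |u_{m−1}|)^γ for all u = (u₁,…,u_{m−1}) ∈ ℝ^{m−1}, for some constants C > 0 and γ ∈ (0,1]. Then for every ε > 0, Δ_W(T) := | S_W(T) − (2π)^{m−1} ∫_ℝ h₁(λ)⋯h_m(λ) dλ | = O(T^{−γ+ε}) as T → ∞. -/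
open MeasureTheory Filter Set Asymptotics Real
open scoped ENNReal Topology

noncomputable section

/-- Dirichlet-type kernel. -/
def DK (T y : ℝ) : ℂ := ∫ u in Icc (0 : ℝ) T, Complex.exp (Complex.I * y * u)

lemma DK_eq (T : ℝ) (hT : 0 ≤ T) (y : ℝ) :
    DK T y = ∫ u in (0 : ℝ)..T, Complex.exp (Complex.I * y * u) := by
  rw [DK, integral_Icc_eq_integral_Ioc, intervalIntegral.integral_of_le hT]

lemma DK_continuous (T : ℝ) (hT : 0 ≤ T) : Continuous (DK T) := by
  have : DK T = fun y : ℝ => ∫ u in (0 : ℝ)..T, Complex.exp (Complex.I * y * u) := by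
    ext y; exact DK_eq T hT y
  rw [this]
  apply intervalIntegral.continuous_parametric_intervalIntegral_of_continuous'
  fun_prop

lemma norm_exp_Imul (y u : ℝ) : ‖Complex.exp (Complex.I * y * u)‖ = 1 := by
  rw [Complex.norm_exp]; simp

lemma DK_zero (T : ℝ) (hT : 0 ≤ T) : DK T 0 = T := by
  rw [DK_eq T hT]; simp

lemma DK_bound1 (T : ℝ) (hT : 0 ≤ T) (y : ℝ) : ‖DK T y‖ ≤ T := by
  rw [DK_eq T hT]
  have := intervalIntegral.norm_integral_le_of_norm_le_const (a := 0) (b := T) (C := 1)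
    (f := fun u : ℝ => Complex.exp (Complex.I * y * u))
    (fun x _ => (norm_exp_Imul y x).le)
  simpa [abs_of_nonneg hT] using this

lemma DK_bound2 (T : ℝ) (hT : 0 ≤ T) (y : ℝ) : |y| * ‖DK T y‖ ≤ 2 := by
  by_cases hy : y = 0
  · simp [hy]
  rw [DK_eq T hT, integral_exp_mul_complex (by simp [hy])]
  rw [norm_div]
  have h1 : ‖Complex.I * (y : ℂ)‖ = |y| := by simp
  rw [h1, mul_div_cancel₀ _ (by simpa using hy)]
  refine (norm_sub_le _ _).trans ?_
  rw [norm_exp_Imul, norm_exp_Imul]; norm_num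

lemma DK_bound (T : ℝ) (hT : 0 < T) (y : ℝ) : ‖DK T y‖ ≤ 3 * T * (1 + |T * y|)⁻¹ := by
  have h1 := DK_bound1 T hT.le y
  have h2 := DK_bound2 T hT.le y
  rw [← div_eq_mul_inv, le_div_iff₀ (by positivity), abs_mul, abs_of_pos hT]
  nlinarith

lemma DK_sq_integrable (T : ℝ) (hT : 0 < T) : Integrable (fun y => ‖DK T y‖ ^ 2) := by
  have h0 : Integrable (fun x : ℝ => (1 + ‖x‖) ^ (-(2:ℝ))) :=
    integrable_one_add_norm (by simp)
  have h1 : Integrable (fun x : ℝ => (1 + ‖T • x‖) ^ (-(2:ℝ))) :=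
    (integrable_comp_smul_iff volume (fun x : ℝ => (1 + ‖x‖) ^ (-(2:ℝ))) hT.ne').2 h0
  refine (h1.const_mul ((3 * T) ^ 2)).mono' ?_ ?_
  · exact ((DK_continuous T hT.le).norm.pow 2).aestronglyMeasurable
  · refine ae_of_all _ fun y => ?_
    have := DK_bound T hT y
    rw [Real.norm_of_nonneg (by positivity), Real.rpow_neg (by positivity), Real.rpow_two,
      ← inv_pow, ← mul_pow]
    exact pow_le_pow_left₀ (norm_nonneg _) this 2

lemma DK_mul_integrable (T : ℝ) (hT : 0 < T) (z : ℝ) :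
    Integrable (fun y => DK T (0 - y) * DK T (y - z)) := by
  have hc := DK_continuous T hT.le
  have h1 := (DK_sq_integrable T hT).comp_sub_left (0 : ℝ)
  have h2 := (DK_sq_integrable T hT).comp_sub_right z
  refine (h1.add h2).mono' ?_ ?_
  · exact Continuous.aestronglyMeasurable (by fun_prop)
  · refine ae_of_all _ fun y => ?_
    rw [norm_mul]
    simp only [Pi.add_apply]
    nlinarith [sq_nonneg (‖DK T (0 - y)‖ - ‖DK T (y - z)‖), sq_nonneg ‖DK T (0 - y)‖,
      sq_nonneg ‖DK T (y - z)‖]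

open FourierTransform Convolution in
lemma DK_conv (T : ℝ) (hT : 0 < T) (z : ℝ) :
    ∫ y, DK T (0 - y) * DK T (y - z) = 2 * π * DK T (0 - z) := by
  set f₁ : ℝ → ℂ := (Icc (0 : ℝ) T).indicator (fun _ => 1) with hf₁
  set f₂ : ℝ → ℂ := (Icc (-T) 0).indicator (fun u => Complex.exp (Complex.I * z * u)) with hf₂
  have i1 : Integrable f₁ := by
    rw [hf₁, integrable_indicator_iff measurableSet_Icc]
    exact Continuous.integrableOn_Icc (by fun_prop)
  have i2 : Integrable f₂ := by
    rw [hf₂, integrable_indicator_iff measurableSet_Icc]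
    exact Continuous.integrableOn_Icc (by fun_prop)
  have F1 : ∀ ξ : ℝ, 𝓕 f₁ ξ = DK T (0 - 2 * π * ξ) := by
    intro ξ
    rw [Real.fourier_real_eq_integral_exp_smul, DK, ← integral_indicator measurableSet_Icc]
    congr 1; ext u
    by_cases hu : u ∈ Icc (0 : ℝ) T
    · simp only [hf₁, indicator_of_mem hu, smul_eq_mul, mul_one]
      congr 1; push_cast; ring
    · simp [hf₁, indicator_of_notMem hu]
  have F2 : ∀ ξ : ℝ, 𝓕 f₂ ξ = DK T (2 * π * ξ - z) := by
    intro ξ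
    rw [Real.fourier_real_eq_integral_exp_smul, DK, ← integral_indicator measurableSet_Icc,
      ← integral_neg_eq_self]
    congr 1; ext u
    by_cases hu : u ∈ Icc (0 : ℝ) T
    · have hu' : -u ∈ Icc (-T) 0 := ⟨by linarith [hu.2], by linarith [hu.1]⟩
      simp only [hf₂, indicator_of_mem hu, indicator_of_mem hu', smul_eq_mul, ← Complex.exp_add]
      congr 1; push_cast; ring
    · have hu' : -u ∉ Icc (-T) 0 := fun h => hu ⟨by linarith [h.2], by linarith [h.1]⟩
      simp [hf₂, indicator_of_notMem hu, indicator_of_notMem hu']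
  set g := (f₁ ⋆[ContinuousLinearMap.mul ℂ ℂ] f₂) with hg
  have Fg : ∀ ξ : ℝ, 𝓕 g ξ = DK T (0 - 2 * π * ξ) * DK T (2 * π * ξ - z) := by
    intro ξ
    rw [hg, Real.fourier_mul_convolution_eq i1 i2, F1, F2]
  have ig : Integrable g := i1.integrable_convolution _ i2
  have iFg : Integrable (𝓕 g) := by
    have := (integrable_comp_smul_iff volume (fun y : ℝ => DK T (0 - y) * DK T (y - z))
      (R := 2 * π) (by positivity)).2 (DK_mul_integrable T hT z)
    refine this.congr (ae_of_all _ fun ξ => ?_)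
    simp [Fg]
  have cg : ContinuousAt g 0 := by
    have hgd : g = fun x => ∫ t, f₁ t * f₂ (x - t) := by
      ext x; simp [hg, convolution_def]
    rw [hgd]
    have hm2 : Measurable f₂ := by
      rw [hf₂]; exact Measurable.indicator (by fun_prop) measurableSet_Icc
    have hm1 : Measurable f₁ := by
      rw [hf₁]; exact Measurable.indicator (by fun_prop) measurableSet_Icc
    refine continuousAt_of_dominated (bound := fun t => ‖f₁ t‖) ?_ ?_ i1.norm ?_
    · refine Eventually.of_forall fun x => ?_
      exact (hm1.mul (hm2.comp (by fun_prop))).aestronglyMeasurable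
    · refine Eventually.of_forall fun x => ae_of_all _ fun t => ?_
      rw [norm_mul]
      refine mul_le_of_le_one_right (norm_nonneg _) ?_
      refine (norm_indicator_le_norm_self _ _).trans ?_
      rw [norm_exp_Imul]
    · have : ∀ᵐ t : ℝ, t ≠ 0 ∧ t ≠ T := by
        refine Filter.Eventually.and ?_ ?_ <;> exact Measure.ae_ne _ _
      filter_upwards [this] with t ht
      refine continuousAt_const.mul ?_
      have h2 : ContinuousAt f₂ (0 - t) := by
        by_cases hu : 0 - t ∈ Icc (-T) 0
        · have : f₂ =ᶠ[𝓝 (0 - t)] fun u => Complex.exp (Complex.I * z * u) := by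
            have hI : Ioo (-T) 0 ∈ 𝓝 (0 - t) := by
              refine Ioo_mem_nhds (lt_of_le_of_ne hu.1 ?_) (lt_of_le_of_ne hu.2 ?_)
              · intro h; apply ht.2; linarith
              · intro h; apply ht.1; linarith
            filter_upwards [hI] with u hu
            simp [hf₂, indicator_of_mem (Ioo_subset_Icc_self hu)]
          refine ContinuousAt.congr ?_ this.symm
          exact Continuous.continuousAt (by fun_prop)
        · have : f₂ =ᶠ[𝓝 (0 - t)] fun u => 0 := by
            filter_upwards [isClosed_Icc.isOpen_compl.mem_nhds hu] with u hu
            exact indicator_of_notMem hu _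
          exact continuousAt_const.congr this.symm
      exact ContinuousAt.comp (f := fun x : ℝ => x - t) h2 (by fun_prop)
  have key := ig.fourierInv_fourier_eq iFg cg
  rw [Real.fourierInv_eq] at key
  simp only [inner_zero_right, AddChar.map_zero_eq_one, one_smul] at key
  have hg0 : g 0 = DK T (0 - z) := by
    simp only [hg, convolution_def]
    rw [DK, ← integral_indicator measurableSet_Icc]
    congr 1; ext u
    by_cases hu : u ∈ Icc (0 : ℝ) T
    · have hu' : 0 - u ∈ Icc (-T) 0 := ⟨by linarith [hu.2], by linarith [hu.1]⟩
      simp only [hf₁, hf₂, indicator_of_mem hu, indicator_of_mem hu']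
      simp
    · simp [hf₁, indicator_of_notMem hu]
  rw [hg0] at key
  have hs := Measure.integral_comp_smul volume (fun y : ℝ => DK T (0 - y) * DK T (y - z)) (2 * π)
  simp only [smul_eq_mul] at hs
  have h3 : ∫ v, 𝓕 g v = ∫ x : ℝ, DK T (0 - 2 * π * x) * DK T (2 * π * x - z) := by
    congr 1; ext v; exact Fg v
  rw [h3, hs] at key
  rw [← key]
  have : |((2 * π) ^ Module.finrank ℝ ℝ)⁻¹| = (2 * π)⁻¹ := by
    rw [Module.finrank_self, pow_one, abs_of_pos (by positivity)]
  rw [this, Complex.real_smul]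
  push_cast
  have : (2 * (π : ℂ)) ≠ 0 := by
    have := Real.pi_ne_zero
    simp [this]
  field_simp

/-- Cyclic differences of `(0, u₁, …, uₙ)`. -/
def wd {n : ℕ} (u : Fin n → ℝ) (i : Fin (n + 1)) : ℝ :=
  (Fin.cons 0 u : Fin (n + 1) → ℝ) i - (Fin.snoc u 0 : Fin (n + 1) → ℝ) i

lemma wd_cons_succ {n : ℕ} (u : Fin n → ℝ) (i : Fin (n + 1)) :
    (Fin.snoc u 0 : Fin (n + 1) → ℝ) i = (Fin.cons 0 u : Fin (n + 1) → ℝ) (i + 1) := by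
  induction i using Fin.lastCases with
  | last => simp
  | cast j => simp [Fin.coeSucc_eq_succ]

lemma cons_continuous {n : ℕ} (i : Fin (n + 1)) :
    Continuous fun u : Fin n → ℝ => (Fin.cons 0 u : Fin (n + 1) → ℝ) i := by
  induction i using Fin.cases with
  | zero => simpa using continuous_const
  | succ j => simpa using continuous_apply j

lemma wd_continuous {n : ℕ} (i : Fin (n + 1)) :
    Continuous fun u : Fin n → ℝ => wd u i := by
  simp only [wd, wd_cons_succ]
  exact (cons_continuous i).sub (cons_continuous (i + 1))

lemma cons_add' {n : ℕ} (u v : Fin n → ℝ) (i : Fin (n + 1)) :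
    (Fin.cons 0 (u + v) : Fin (n + 1) → ℝ) i =
      (Fin.cons 0 u : Fin (n + 1) → ℝ) i + (Fin.cons 0 v : Fin (n + 1) → ℝ) i := by
  induction i using Fin.cases with
  | zero => simp
  | succ j => simp

lemma cons_smul' {n : ℕ} (c : ℝ) (u : Fin n → ℝ) (i : Fin (n + 1)) :
    (Fin.cons 0 (c • u) : Fin (n + 1) → ℝ) i = c * (Fin.cons 0 u : Fin (n + 1) → ℝ) i := by
  induction i using Fin.cases with
  | zero => simp
  | succ j => simp

lemma wd_add {n : ℕ} (u v : Fin n → ℝ) (i : Fin (n + 1)) :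
    wd (u + v) i = wd u i + wd v i := by
  simp only [wd, wd_cons_succ, cons_add']; ring

lemma wd_smul {n : ℕ} (c : ℝ) (u : Fin n → ℝ) (i : Fin (n + 1)) :
    wd (c • u) i = c * wd u i := by
  simp only [wd, wd_cons_succ, cons_smul']; ring

lemma wd_sum {n : ℕ} (u : Fin n → ℝ) : ∑ i, wd u i = 0 := by
  simp only [wd, Finset.sum_sub_distrib]
  rw [Fin.sum_univ_succ, Fin.sum_univ_castSucc (f := (Fin.snoc u 0 : Fin (n + 1) → ℝ))]
  simp

lemma wd_le {n : ℕ} (u : Fin n → ℝ) (M : ℝ) (hM : ∀ i, |wd u i| ≤ M) (j : Fin n) :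
    |u j| ≤ n * M := by
  have hM0 : 0 ≤ M := (abs_nonneg _).trans (hM 0)
  have key : ∀ k : Fin (n + 1), |(Fin.cons 0 u : Fin (n + 1) → ℝ) k| ≤ (k : ℕ) * M := by
    intro k
    induction k using Fin.induction with
    | zero => simp
    | succ i ih =>
      have h1 := hM i.castSucc
      rw [wd, wd_cons_succ, Fin.coeSucc_eq_succ] at h1
      have h2 := abs_sub_abs_le_abs_sub ((Fin.cons 0 u : Fin (n + 1) → ℝ) i.succ)
        ((Fin.cons 0 u : Fin (n + 1) → ℝ) i.castSucc)
      rw [abs_sub_comm] at h2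
      have : ((i.succ : Fin (n+1)) : ℕ) = ((i.castSucc : Fin (n + 1)) : ℕ) + 1 := by simp
      rw [this]; push_cast
      push_cast at ih
      linarith
  have := key j.succ
  simp only [Fin.cons_succ] at this
  refine this.trans ?_
  gcongr
  have := j.2
  simp

/-- The linear map dropping one cyclic difference. -/
def wL {n : ℕ} (k : Fin (n + 1)) : (Fin n → ℝ) →ₗ[ℝ] (Fin n → ℝ) where
  toFun u := fun j => wd u (k.succAbove j)
  map_add' u v := by ext j; simp [wd_add]
  map_smul' c u := by ext j; simp [wd_smul]

lemma wL_det {n : ℕ} (k : Fin (n + 1)) : LinearMap.det (wL k) ≠ 0 := by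
  have hinj : LinearMap.ker (wL k) = ⊥ := by
    rw [LinearMap.ker_eq_bot']
    intro u hu
    have h1 : ∀ j, wd u (k.succAbove j) = 0 := fun j => congrFun hu j
    have h2 : wd u k = 0 := by
      have := wd_sum u
      rw [Fin.sum_univ_succAbove _ k] at this
      simpa [h1] using this
    have h3 : ∀ i, |wd u i| ≤ 0 := by
      intro i
      rcases Fin.eq_self_or_eq_succAbove k i with h | ⟨j, h⟩
      · simp [h, h2]
      · simp [h, h1]
    ext j
    simpa using wd_le u 0 h3 j
  intro h
  exact (LinearMap.bot_lt_ker_of_det_eq_zero h).ne' hinj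

lemma integrable_wL {n : ℕ} (k : Fin (n + 1)) (r : ℝ) (hr : 1 < r) :
    Integrable (fun u : Fin n → ℝ => ∏ j, (1 + |wd u (k.succAbove j)|) ^ (-r)) := by
  have h0 : Integrable (fun x : ℝ => (1 + ‖x‖) ^ (-r)) :=
    integrable_one_add_norm (by simpa using hr)
  have h1 : Integrable (fun v : Fin n → ℝ => ∏ j, (1 + ‖v j‖) ^ (-r)) :=
    Integrable.fintype_prod (f := fun _ (x : ℝ) => (1 + ‖x‖) ^ (-r)) (fun _ => h0)
  have hmap := Measure.map_linearMap_addHaar_eq_smul_addHaar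
    (volume : Measure (Fin n → ℝ)) (wL_det k)
  have h2 : Integrable (fun v : Fin n → ℝ => ∏ j, (1 + ‖v j‖) ^ (-r))
      (Measure.map (wL k) volume) := by
    rw [hmap]
    exact h1.smul_measure ENNReal.ofReal_ne_top
  exact h2.comp_measurable (wL k).continuous_of_finiteDimensional.measurable

/-- The weighted kernel is dominated. -/
lemma G_bound {n : ℕ} (δ : ℝ) (hδ : 0 ≤ δ) (hδ1 : δ < 1) (u : Fin n → ℝ) :
    (∑ j, |u j|) ^ δ * ∏ i, (1 + |wd u i|)⁻¹ ≤
      ((n : ℝ) * n) ^ δ *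
        ∑ k : Fin (n + 1), ∏ j, (1 + |wd u (k.succAbove j)|) ^ (-(1 + (1 - δ) / (n + 1))) := by
  obtain ⟨k, -, hk⟩ := Finset.exists_max_image Finset.univ (fun i => |wd u i|) ⟨0, by simp⟩
  have hk' : ∀ i, |wd u i| ≤ |wd u k| := fun i => hk i (by simp)
  set M := |wd u k| with hM
  have hM0 : 0 ≤ M := abs_nonneg _
  have hS : ∑ j, |u j| ≤ (n : ℝ) * n * M := by
    calc ∑ j, |u j| ≤ ∑ _j : Fin n, (n : ℝ) * M := Finset.sum_le_sum fun j _ => wd_le u M hk' j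
      _ = _ := by simp; ring
  have hS1 : (∑ j, |u j|) ^ δ ≤ ((n : ℝ) * n) ^ δ * (1 + M) ^ δ := by
    rw [← Real.mul_rpow (by positivity) (by positivity)]
    refine Real.rpow_le_rpow (Finset.sum_nonneg fun _ _ => abs_nonneg _) (hS.trans ?_) hδ
    gcongr; linarith
  have hsing : ∏ j, (1 + |wd u (k.succAbove j)|) ^ (-(1 + (1 - δ) / (n + 1))) ≤
      ∑ k : Fin (n + 1), ∏ j, (1 + |wd u (k.succAbove j)|) ^ (-(1 + (1 - δ) / (n + 1))) :=
    Finset.single_le_sum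
      (f := fun k : Fin (n + 1) =>
        ∏ j, (1 + |wd u (k.succAbove j)|) ^ (-(1 + (1 - δ) / ((n : ℝ) + 1))))
      (fun i _ => Finset.prod_nonneg fun j _ => by positivity) (Finset.mem_univ k)
  have hmain : (1 + M) ^ δ * ∏ i, (1 + |wd u i|)⁻¹ ≤
      ∏ j, (1 + |wd u (k.succAbove j)|) ^ (-(1 + (1 - δ) / (n + 1))) := by
    rw [Fin.prod_univ_succAbove _ k, ← hM, ← mul_assoc]
    have e1 : (1 + M) ^ δ * (1 + M)⁻¹ = (1 + M) ^ (-(1 - δ)) := by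
      rw [← Real.rpow_neg_one, ← Real.rpow_add (by positivity)]; congr 1; ring
    have e2 : (1 + M) ^ (-(1 - δ)) ≤ ∏ j : Fin n, (1 + |wd u (k.succAbove j)|) ^
        (-((1 - δ) / (n + 1))) := by
      calc (1 + M) ^ (-(1 - δ)) ≤ (1 + M) ^ (-((1 - δ) / (n + 1)) * n) := by
            apply Real.rpow_le_rpow_of_exponent_le (by linarith)
            have h0 : 0 < (n : ℝ) + 1 := by positivity
            have : (1 - δ) / (n + 1) * n ≤ 1 - δ := by
              rw [div_mul_eq_mul_div, div_le_iff₀ h0]; nlinarith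
            linarith
        _ = ∏ _j : Fin n, (1 + M) ^ (-((1 - δ) / (n + 1))) := by
            rw [Finset.prod_const, Finset.card_univ, Fintype.card_fin,
              Real.rpow_mul (by positivity), Real.rpow_natCast]
        _ ≤ _ := by
            refine Finset.prod_le_prod (fun j _ => by positivity) fun j _ => ?_
            apply Real.rpow_le_rpow_of_nonpos (by positivity)
            · linarith [hk' (k.succAbove j)]
            · have : 0 ≤ (1 - δ) / (n + 1) := div_nonneg (by linarith) (by positivity)
              linarith
    rw [e1]
    calc _ ≤ (∏ j : Fin n, (1 + |wd u (k.succAbove j)|) ^ (-((1 - δ) / (n + 1)))) *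
          ∏ j : Fin n, (1 + |wd u (k.succAbove j)|)⁻¹ := by
            gcongr
      _ = _ := by
            rw [← Finset.prod_mul_distrib]
            refine Finset.prod_congr rfl fun j _ => ?_
            rw [← Real.rpow_neg_one, ← Real.rpow_add (by positivity)]; congr 1; ring
  calc _ ≤ ((n : ℝ) * n) ^ δ * (1 + M) ^ δ * ∏ i, (1 + |wd u i|)⁻¹ := by gcongr
    _ = ((n : ℝ) * n) ^ δ * ((1 + M) ^ δ * ∏ i, (1 + |wd u i|)⁻¹) := by ring
    _ ≤ _ := by gcongr; exact hmain.trans hsing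

lemma G_integrable (n : ℕ) (δ : ℝ) (hδ : 0 ≤ δ) (hδ1 : δ < 1) :
    Integrable (fun u : Fin n → ℝ => (∑ j, |u j|) ^ δ * ∏ i, (1 + |wd u i|)⁻¹) := by
  have h1 : Integrable (fun u : Fin n → ℝ => ((n : ℝ) * n) ^ δ *
        ∑ k : Fin (n + 1), ∏ j, (1 + |wd u (k.succAbove j)|) ^ (-(1 + (1 - δ) / (n + 1)))) := by
    refine Integrable.const_mul (integrable_finsetSum _ fun k _ => ?_) _
    refine integrable_wL k _ ?_
    have : 0 < (1 - δ) / ((n : ℝ) + 1) := div_pos (by linarith) (by positivity)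
    linarith
  refine h1.mono' ?_ (ae_of_all _ fun u => ?_)
  · apply Measurable.aestronglyMeasurable
    have := fun i => (wd_continuous (n := n) i).measurable
    refine Measurable.mul ?_ ?_
    · fun_prop
    · refine Finset.measurable_prod _ fun i _ => ?_
      exact ((this i).abs.const_add 1).inv
  · rw [Real.norm_of_nonneg]
    · exact G_bound δ hδ hδ1 u
    · have : 0 ≤ ∑ j, |u j| := Finset.sum_nonneg fun _ _ => abs_nonneg _
      positivity

/-- The cyclic kernel on `ℝⁿ`. -/
def KK (n : ℕ) (T : ℝ) (u : Fin n → ℝ) : ℂ := ∏ i, DK T (wd u i)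

lemma KK_continuous (n : ℕ) (T : ℝ) (hT : 0 < T) : Continuous (KK n T) := by
  unfold KK
  exact continuous_finsetProd _ fun i _ => (DK_continuous T hT.le).comp (wd_continuous i)

lemma KK_bound (n : ℕ) (T : ℝ) (hT : 0 < T) (u : Fin n → ℝ) :
    ‖KK n T u‖ ≤ (3 * T) ^ (n + 1) * ∏ i, (1 + |wd (T • u) i|)⁻¹ := by
  rw [KK, norm_prod]
  calc _ ≤ ∏ i : Fin (n + 1), (3 * T * (1 + |wd (T • u) i|)⁻¹) := by
        refine Finset.prod_le_prod (fun i _ => norm_nonneg _) fun i _ => ?_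
        rw [wd_smul]; exact DK_bound T hT _
    _ = _ := by rw [Finset.prod_mul_distrib]; simp

lemma KK_integrable (n : ℕ) (T : ℝ) (hT : 0 < T) : Integrable (KK n T) := by
  have h1 := G_integrable n 0 le_rfl one_pos
  have h2 := ((integrable_comp_smul_iff volume _ hT.ne').2 h1).const_mul ((3 * T) ^ (n + 1))
  refine h2.mono' (KK_continuous n T hT).aestronglyMeasurable (ae_of_all _ fun u => ?_)
  simpa using KK_bound n T hT u

lemma piFin_symm {n : ℕ} (p : ℝ × (Fin n → ℝ)) :
    (MeasurableEquiv.piFinSuccAbove (fun _ : Fin (n + 1) => ℝ) 0).symm p = Fin.cons p.1 p.2 := by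
  simp [MeasurableEquiv.piFinSuccAbove_symm_apply, Fin.insertNthEquiv, Fin.insertNth_zero']

lemma cons_integral {n : ℕ} {E : Type*} [NormedAddCommGroup E] [NormedSpace ℝ E]
    (f : (Fin (n + 1) → ℝ) → E) :
    ∫ x, f x = ∫ p : ℝ × (Fin n → ℝ), f (Fin.cons p.1 p.2) := by
  have := (volume_preserving_piFinSuccAbove (fun _ : Fin (n + 1) => ℝ) 0).symm
  rw [← this.integral_comp']
  simp_rw [piFin_symm]

lemma cons_integrable {n : ℕ} {E : Type*} [NormedAddCommGroup E]
    (f : (Fin (n + 1) → ℝ) → E) :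
    Integrable f ↔ Integrable (fun p : ℝ × (Fin n → ℝ) => f (Fin.cons p.1 p.2)) := by
  have := (volume_preserving_piFinSuccAbove (fun _ : Fin (n + 1) => ℝ) 0).symm
  rw [← this.integrable_comp_emb (MeasurableEquiv.measurableEmbedding _)]
  simp only [Function.comp_def, piFin_symm]

lemma KK_integral (n : ℕ) (T : ℝ) (hT : 0 < T) :
    ∫ u, KK n T u = (2 * π) ^ n * T := by
  induction n with
  | zero =>
    rw [integral_unique]
    have h0 : ∀ u : Fin 0 → ℝ, wd u 0 = 0 := fun u => by
      have := wd_sum u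
      simpa using this
    have h1 : (volume : Measure (Fin 0 → ℝ)) univ = 1 := by
      simp [volume_pi]
    simp [KK, h0, DK_zero T hT.le, measureReal_def, h1]
  | succ n ih =>
    have hint := (cons_integrable _).1 (KK_integrable (n + 1) T hT)
    rw [cons_integral]
    rw [Measure.volume_eq_prod] at hint ⊢
    rw [integral_prod_symm _ hint]
    have : ∀ v : Fin n → ℝ, ∫ y : ℝ, KK (n + 1) T (Fin.cons y v) = 2 * π * KK n T v := by
      intro v
      have h1 : ∀ y : ℝ, KK (n + 1) T (Fin.cons y v) =
          (DK T (0 - y) * DK T (y - (Fin.snoc v 0 : Fin (n + 1) → ℝ) 0)) *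
            ∏ i : Fin n, DK T (v i - (Fin.snoc v 0 : Fin (n + 1) → ℝ) i.succ) := by
        intro y
        have hcs : (Fin.snoc (Fin.cons y v : Fin (n + 1) → ℝ) 0 : Fin (n + 2) → ℝ) =
            Fin.cons y (Fin.snoc v 0 : Fin (n + 1) → ℝ) :=
          (Fin.cons_snoc_eq_snoc_cons y v 0).symm
        simp only [KK, wd]
        rw [hcs, Fin.prod_univ_succ, Fin.prod_univ_succ]
        simp only [Fin.cons_zero, Fin.cons_succ]
        ring
      simp_rw [h1]
      rw [integral_mul_const, DK_conv T hT, KK, Fin.prod_univ_succ]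
      simp only [wd, Fin.cons_zero, Fin.cons_succ]
      ring
    simp_rw [this]
    rw [integral_const_mul, ih]
    ring

lemma exp_cyc {n : ℕ} (t x : Fin (n + 1) → ℝ) :
    ∏ i, Complex.exp (Complex.I * x i * ((t i - t (i + 1) : ℝ) : ℂ)) =
      ∏ i, Complex.exp (Complex.I * ((x i - x (i - 1) : ℝ) : ℂ) * t i) := by
  rw [← Complex.exp_sum, ← Complex.exp_sum]
  congr 1
  have h1 : ∑ i, Complex.I * (x (i - 1) : ℂ) * t i = ∑ i, Complex.I * (x i : ℂ) * t (i + 1) := by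
    rw [← Equiv.sum_comp (Equiv.addRight (1 : Fin (n + 1)))]
    simp
  have e1 : ∀ i, Complex.I * x i * ((t i - t (i + 1) : ℝ) : ℂ) =
      Complex.I * x i * t i - Complex.I * x i * t (i + 1) := fun i => by push_cast; ring
  have e2 : ∀ i, Complex.I * ((x i - x (i - 1) : ℝ) : ℂ) * t i =
      Complex.I * x i * t i - Complex.I * x (i - 1) * t i := fun i => by push_cast; ring
  simp_rw [e1, e2, Finset.sum_sub_distrib, h1]

lemma H_integrable {n : ℕ} (h : Fin n → ℝ → ℝ) (hint : ∀ i, Integrable (h i)) :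
    Integrable (fun x : Fin n → ℝ => ∏ i, (h i (x i) : ℂ)) :=
  Integrable.fintype_prod (f := fun i (x : ℝ) => (h i x : ℂ)) (fun i => (hint i).ofReal)

lemma SW_step1 {n : ℕ} (h : Fin (n + 1) → ℝ → ℝ) (hint : ∀ i, Integrable (h i)) (T : ℝ) :
    (∫ t in Set.univ.pi (fun _ : Fin (n + 1) => Icc (0 : ℝ) T),
      ∏ i, hatR (h i) (t i - t (i + 1))) =
    ∫ x : Fin (n + 1) → ℝ, (∏ i, (h i (x i) : ℂ)) * ∏ i, DK T (x (i + 1) - x i) := by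
  have hμ : (volume : Measure (Fin (n + 1) → ℝ)).restrict
      (Set.univ.pi (fun _ : Fin (n + 1) => Icc (0 : ℝ) T)) =
      Measure.pi (fun _ => volume.restrict (Icc (0 : ℝ) T)) := by
    rw [volume_pi, Measure.restrict_pi_pi]
  rw [hμ]
  set μ : Measure (Fin (n + 1) → ℝ) := Measure.pi (fun _ => volume.restrict (Icc (0 : ℝ) T))
  have hH := H_integrable h hint
  set H : (Fin (n + 1) → ℝ) → ℂ := fun x => ∏ i, (h i (x i) : ℂ) with hHd
  have e1 : ∀ t : Fin (n + 1) → ℝ, ∏ i, hatR (h i) (t i - t (i + 1)) =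
      ∫ x : Fin (n + 1) → ℝ,
        (∏ i, Complex.exp (Complex.I * x i * ((t i - t (i + 1) : ℝ) : ℂ))) * H x := by
    intro t
    simp only [hatR, hHd, ← Finset.prod_mul_distrib]
    exact (integral_fintype_prod_volume_eq_prod (fun i (x : ℝ) =>
      Complex.exp (Complex.I * x * ((t i - t (i + 1) : ℝ) : ℂ)) * (h i x : ℂ))).symm
  simp_rw [e1]
  rw [integral_integral_swap]
  · congr 1; ext x
    rw [integral_mul_const, mul_comm]
    congr 1
    simp_rw [exp_cyc]
    rw [integral_fintype_prod_eq_prod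
      (fun i (t : ℝ) => Complex.exp (Complex.I * ((x i - x (i - 1) : ℝ) : ℂ) * t))]
    rw [← Equiv.prod_comp (Equiv.addRight (1 : Fin (n + 1)))]
    simp [DK]
  · have hb : Integrable (fun p : (Fin (n + 1) → ℝ) × (Fin (n + 1) → ℝ) => (1 : ℝ) * ‖H p.2‖)
        (μ.prod volume) := (integrable_const (1 : ℝ)).mul_prod hH.norm
    refine hb.mono' ?_ (ae_of_all _ fun p => ?_)
    · refine AEStronglyMeasurable.mul ?_ hH.aestronglyMeasurable.comp_snd
      exact Continuous.aestronglyMeasurable (by fun_prop)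
    · simp only [Function.uncurry, norm_mul, norm_prod, norm_exp_Imul]
      simp

lemma flip_preserving (n : ℕ) :
    MeasurePreserving (fun p : ℝ × (Fin n → ℝ) => (p.1, fun j => p.1 - p.2 j))
      (volume.prod volume) (volume.prod volume) := by
  refine MeasurePreserving.skew_product (g := fun (x : ℝ) (y : Fin n → ℝ) => fun j => x - y j)
    (MeasurePreserving.id _) ?_ ?_
  · unfold Function.uncurry; fun_prop
  · refine ae_of_all _ fun x => ?_
    exact (Measure.measurePreserving_sub_left (volume : Measure (Fin n → ℝ)) (fun _ => x)).map_eq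

/-- The involution `(x, y) ↦ (x, x - y)`. -/
def flipEquiv (n : ℕ) : ℝ × (Fin n → ℝ) ≃ᵐ ℝ × (Fin n → ℝ) :=
  MeasurableEquiv.ofInvolutive (fun p => (p.1, fun j => p.1 - p.2 j))
    (fun p => by ext <;> simp) (by fun_prop)

lemma SW_step2 {n : ℕ} (h : Fin (n + 1) → ℝ → ℝ) (hint : ∀ i, Integrable (h i)) (T : ℝ)
    (hT : 0 < T) (φ : (Fin n → ℝ) → ℝ)
    (hφ : ∀ u, φ u = ∫ x : ℝ, h 0 x * ∏ j : Fin n, h j.succ (x - u j)) :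
    Integrable (fun u => (φ u : ℂ) * KK n T u) ∧
    ∫ x : Fin (n + 1) → ℝ, (∏ i, (h i (x i) : ℂ)) * ∏ i, DK T (x (i + 1) - x i) =
      ∫ u, (φ u : ℂ) * KK n T u := by
  have hc := DK_continuous T hT.le
  have hI : Integrable (fun x : Fin (n + 1) → ℝ =>
      (∏ i, (h i (x i) : ℂ)) * ∏ i, DK T (x (i + 1) - x i)) := by
    have hH := H_integrable h hint
    refine (hH.norm.mul_const (T ^ (n + 1))).mono' ?_ (ae_of_all _ fun x => ?_)
    · refine hH.aestronglyMeasurable.mul (Continuous.aestronglyMeasurable ?_)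
      exact continuous_finsetProd _ fun i _ => hc.comp (by fun_prop)
    · rw [norm_mul]
      gcongr
      rw [norm_prod]
      calc _ ≤ ∏ _i : Fin (n + 1), T :=
            Finset.prod_le_prod (fun _ _ => norm_nonneg _) fun i _ => DK_bound1 T hT.le _
        _ = _ := by simp
  have hpres : MeasurePreserving (flipEquiv n) (volume.prod volume) (volume.prod volume) :=
    flip_preserving n
  have hpt : ∀ p : ℝ × (Fin n → ℝ),
      (∏ i, (h i ((Fin.cons (flipEquiv n p).1 (flipEquiv n p).2 : Fin (n + 1) → ℝ) i) : ℂ)) *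
        ∏ i, DK T ((Fin.cons (flipEquiv n p).1 (flipEquiv n p).2 : Fin (n + 1) → ℝ) (i + 1) -
          (Fin.cons (flipEquiv n p).1 (flipEquiv n p).2 : Fin (n + 1) → ℝ) i) =
      ((h 0 p.1 * ∏ j : Fin n, h j.succ (p.1 - p.2 j) : ℝ) : ℂ) * KK n T p.2 := by
    rintro ⟨x, u⟩
    have hfl : flipEquiv n (x, u) = (x, fun j => x - u j) := rfl
    rw [hfl]
    have hcons : ∀ i, (Fin.cons x (fun j => x - u j) : Fin (n + 1) → ℝ) i =
        x - (Fin.cons 0 u : Fin (n + 1) → ℝ) i := by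
      intro i
      induction i using Fin.cases with
      | zero => simp
      | succ j => simp
    congr 1
    · rw [Fin.prod_univ_succ]
      simp
    · rw [KK]
      refine Finset.prod_congr rfl fun i _ => ?_
      simp only [hcons, wd, wd_cons_succ]
      congr 1; ring
  have hI2 := (cons_integrable _).1 hI
  rw [Measure.volume_eq_prod] at hI2
  have hI3 := (hpres.integrable_comp_emb (flipEquiv n).measurableEmbedding).2 hI2
  simp only [Function.comp_def, hpt] at hI3
  have hφ' : ∀ u : Fin n → ℝ, ∫ x : ℝ,
      ((h 0 x * ∏ j : Fin n, h j.succ (x - u j) : ℝ) : ℂ) * KK n T u = (φ u : ℂ) * KK n T u := by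
    intro u
    rw [integral_mul_const, integral_complex_ofReal, hφ u]
  constructor
  · have := hI3.integral_prod_right
    simpa only [hφ'] using this
  · rw [cons_integral, Measure.volume_eq_prod, ← hpres.integral_comp']
    simp only [hpt]
    rw [integral_prod_symm _ hI3]
    simp only [hφ']

lemma main_bound {n : ℕ} (T : ℝ) (hT : 0 < T) (φ : (Fin n → ℝ) → ℝ) (B δ : ℝ) (hB : 0 ≤ B)
    (hδ : 0 ≤ δ) (hδ1 : δ < 1)
    (hφB : ∀ᵐ u, |φ u - φ 0| ≤ B * (∑ j, |u j|) ^ δ)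
    (hI : Integrable (fun u => (φ u : ℂ) * KK n T u)) :
    ‖(T : ℂ)⁻¹ * (∫ u, (φ u : ℂ) * KK n T u) - (((2 * π) ^ n * φ 0 : ℝ) : ℂ)‖ ≤
      B * 3 ^ (n + 1) *
        (∫ u : Fin n → ℝ, (∑ j, |u j|) ^ δ * ∏ i, (1 + |wd u i|)⁻¹) * T ^ (-δ) := by
  have hTc : (T : ℂ) ≠ 0 := by exact_mod_cast hT.ne'
  have h1 : (T : ℂ)⁻¹ * (∫ u, (φ u : ℂ) * KK n T u) - (((2 * π) ^ n * φ 0 : ℝ) : ℂ) =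
      (T : ℂ)⁻¹ * ∫ u, ((φ u : ℂ) - φ 0) * KK n T u := by
    simp_rw [sub_mul]
    rw [integral_sub hI ((KK_integrable n T hT).const_mul _), integral_const_mul,
      KK_integral n T hT]
    push_cast
    field_simp
  rw [h1, norm_mul, norm_inv, Complex.norm_real, Real.norm_of_nonneg hT.le]
  set G : (Fin n → ℝ) → ℝ := fun u => (∑ j, |u j|) ^ δ * ∏ i, (1 + |wd u i|)⁻¹ with hG
  have hGi : Integrable G := G_integrable n δ hδ hδ1
  have h2 : Integrable (fun u => B * (3 * T) ^ (n + 1) * T ^ (-δ) * G (T • u)) :=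
    ((integrable_comp_smul_iff volume G hT.ne').2 hGi).const_mul _
  have h3 : ‖∫ u, ((φ u : ℂ) - φ 0) * KK n T u‖ ≤
      ∫ u, B * (3 * T) ^ (n + 1) * T ^ (-δ) * G (T • u) := by
    refine norm_integral_le_of_norm_le h2 ?_
    filter_upwards [hφB] with u hu
    have hn : ‖(φ u : ℂ) - φ 0‖ = |φ u - φ 0| := by
      rw [← Complex.ofReal_sub, Complex.norm_real, Real.norm_eq_abs]
    have hS0 : 0 ≤ ∑ j, |u j| := Finset.sum_nonneg fun _ _ => abs_nonneg _
    rw [norm_mul, hn]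
    calc |φ u - φ 0| * ‖KK n T u‖ ≤ (B * (∑ j, |u j|) ^ δ) *
          ((3 * T) ^ (n + 1) * ∏ i, (1 + |wd (T • u) i|)⁻¹) := by
          have := KK_bound n T hT u
          gcongr
      _ = _ := by
          have : ∑ j, |(T • u) j| = T * ∑ j, |u j| := by
            simp [abs_mul, abs_of_pos hT, Finset.mul_sum]
          simp only [hG, this]
          rw [Real.mul_rpow hT.le hS0, Real.rpow_neg hT.le]
          have : T ^ δ ≠ 0 := (Real.rpow_pos_of_pos hT δ).ne'
          field_simp
  rw [integral_const_mul, Measure.integral_comp_smul] at h3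
  have h4 : |(T ^ Module.finrank ℝ (Fin n → ℝ))⁻¹| = (T ^ n)⁻¹ := by
    rw [Module.finrank_fin_fun, abs_of_pos (by positivity)]
  rw [h4, smul_eq_mul] at h3
  calc T⁻¹ * ‖∫ u, ((φ u : ℂ) - φ 0) * KK n T u‖ ≤ T⁻¹ * _ :=
        mul_le_mul_of_nonneg_left h3 (by positivity)
    _ = _ := by
        rw [mul_pow, pow_succ T n]
        field_simp

lemma main_succ (n : ℕ) (h : Fin (n + 1) → ℝ → ℝ)
    (hint : ∀ i, Integrable (h i))
    (φ : (Fin n → ℝ) → ℝ)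
    (hφ : ∀ u, φ u = ∫ x : ℝ, h 0 x * ∏ j : Fin n, h j.succ (x - u j))
    (hφbdd : eLpNorm φ ⊤ volume < ⊤)
    (C γ : ℝ) (hC : 0 < C) (hγ : γ ∈ Ioc (0 : ℝ) 1)
    (hφHolder : ∀ u : Fin n → ℝ, |φ u - φ 0| ≤ C * (∑ j, |u j|) ^ γ) :
    ∀ ε > (0 : ℝ),
      (fun T : ℝ => ΔW (n + 1) h T) =O[atTop] fun T : ℝ => T ^ (-γ + ε) := by
  intro ε hε
  set δ := γ - min ε (γ / 2) with hδd
  have hδ0 : 0 ≤ δ := by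
    have := min_le_right ε (γ / 2); have := hγ.1; linarith
  have hδγ : δ < γ := by
    have : 0 < min ε (γ / 2) := lt_min hε (half_pos hγ.1)
    linarith
  have hδ1 : δ < 1 := hδγ.trans_le hγ.2
  have hδε : -δ ≤ -γ + ε := by
    have := min_le_left ε (γ / 2); linarith
  set M := (eLpNorm φ ⊤ volume).toReal with hM
  have hM0 : 0 ≤ M := ENNReal.toReal_nonneg
  have hae : ∀ᵐ u, |φ u| ≤ M := by
    rw [eLpNorm_exponent_top] at hφbdd hM
    filter_upwards [ae_le_eLpNormEssSup (f := φ) (μ := volume)] with u hu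
    have := ENNReal.toReal_mono hφbdd.ne hu
    simpa [hM] using this
  set B := C + (M + |φ 0|) with hBd
  have hB : 0 ≤ B := by positivity
  have hφB : ∀ᵐ u, |φ u - φ 0| ≤ B * (∑ j, |u j|) ^ δ := by
    filter_upwards [hae] with u hu
    have hS0 : 0 ≤ ∑ j, |u j| := Finset.sum_nonneg fun _ _ => abs_nonneg _
    have hSδ : 0 ≤ (∑ j, |u j|) ^ δ := by positivity
    rcases le_total (∑ j, |u j|) 1 with h1 | h1
    · refine (hφHolder u).trans ?_
      have : (∑ j, |u j|) ^ γ ≤ (∑ j, |u j|) ^ δ :=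
        Real.rpow_le_rpow_of_exponent_ge_of_imp hS0 h1 hδγ.le (fun _ h => absurd h hγ.1.ne')
      have : C * (∑ j, |u j|) ^ γ ≤ C * (∑ j, |u j|) ^ δ := by gcongr
      have : 0 ≤ (M + |φ 0|) * (∑ j, |u j|) ^ δ := by positivity
      nlinarith
    · have h2 : 1 ≤ (∑ j, |u j|) ^ δ := Real.one_le_rpow h1 hδ0
      have h3 : |φ u - φ 0| ≤ M + |φ 0| := (abs_sub _ _).trans (by linarith)
      have h4 : M + |φ 0| ≤ B := by linarith
      nlinarith
  refine IsBigO.of_bound (B * 3 ^ (n + 1) *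
        (∫ u : Fin n → ℝ, (∑ j, |u j|) ^ δ * ∏ i, (1 + |wd u i|)⁻¹)) ?_
  filter_upwards [eventually_ge_atTop (1 : ℝ)] with T hT1
  have hT : 0 < T := by linarith
  obtain ⟨hI, heq⟩ := SW_step2 h hint T hT φ hφ
  have hb := main_bound T hT φ B δ hB hδ0 hδ1 hφB hI
  have hφ0 : ∫ x : ℝ, ∏ i, h i x = φ 0 := by
    rw [hφ 0]
    congr 1; ext x
    rw [Fin.prod_univ_succ]
    simp
  have hΔ : ΔW (n + 1) h T =
      ‖(T : ℂ)⁻¹ * (∫ u, (φ u : ℂ) * KK n T u) - (((2 * π) ^ n * φ 0 : ℝ) : ℂ)‖ := by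
    rw [ΔW, SW, SW_step1 h hint T, heq, hφ0, Nat.add_sub_cancel]
  rw [hΔ, norm_norm]
  refine hb.trans ?_
  rw [Real.norm_of_nonneg (by positivity)]
  refine mul_le_mul_of_nonneg_left (Real.rpow_le_rpow_of_exponent_le hT1 hδε) ?_
  refine mul_nonneg (by positivity) (integral_nonneg fun u => ?_)
  have hS0 : 0 ≤ ∑ j, |u j| := Finset.sum_nonneg fun _ _ => abs_nonneg _
  exact mul_nonneg (Real.rpow_nonneg hS0 _) (Finset.prod_nonneg fun _ _ => by positivity)

theorem stmt11 (m : ℕ) [NeZero m] (hm : 2 ≤ m) (h : Fin m → ℝ → ℝ)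
    (heven : ∀ i, ∀ x : ℝ, h i (-x) = h i x)
    (hint : ∀ i, Integrable (h i))
    (φ : (Fin (m - 1) → ℝ) → ℝ)
    (hφdef : ∀ u : Fin (m - 1) → ℝ,
      φ u = ∫ x : ℝ, h ⟨0, by omega⟩ x *
        ∏ j : Fin (m - 1), h ⟨j.val + 1, by have := j.isLt; omega⟩ (x - u j))
    (hφbdd : eLpNorm φ ⊤ volume < ⊤)
    (C γ : ℝ) (hC : 0 < C) (hγ : γ ∈ Ioc (0 : ℝ) 1)
    (hφHolder : ∀ u : Fin (m - 1) → ℝ,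
      |φ u - φ 0| ≤ C * (∑ j, |u j|) ^ γ) :
    ∀ ε > (0 : ℝ),
      (fun T : ℝ => ΔW m h T) =O[atTop] fun T : ℝ => T ^ (-γ + ε) := by

  obtain ⟨n, rfl⟩ : ∃ n, m = n + 1 := ⟨m - 1, by omega⟩
  intro ε hε
  exact main_succ n h hint φ hφdef hφbdd C γ hC hγ hφHolder ε hε
end
end

section
/- Let h₁, h₂ be even real functions on ℝ, differentiable on ℝ\{0}, such that for some constants C_i > 0 and exponents σ_i > 0, δ_i > 1 with σ₁ + σ₂ < 1 one has: |h_i(λ)| ≤ C_i|λ|^{−σ_i} and |h_i′(λ)| ≤ C_i|λ|^{−σ_i−1} for 0 < |λ| ≤ 1, and |h_i(λ)| ≤ C_i|λ|^{−δ_i} and |h_i′(λ)| ≤ C_i|λ|^{−δ_i−1} for |λ| > 1, for i = 1,2. Then Δ₂(T) := | (1/T) ∫₀ᵀ∫₀ᵀ ĥ₁(t−s) ĥ₂(s−t) dt ds − 2π ∫_ℝ h₁(λ)h₂(λ) dλ | = O(T^{−1+(σ₁+σ₂)}) as T → ∞. -/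
open MeasureTheory Filter Set Asymptotics Real
open scoped ENNReal Topology

noncomputable section

/-- Δ₂(T) = |(1/T)·tr[W_T(h₁)W_T(h₂)] − 2π∫ h₁h₂|. -/
def Δ₂W (h₁ h₂ : ℝ → ℝ) (T : ℝ) : ℝ :=
  ‖(T : ℂ)⁻¹ * (∫ t in (0 : ℝ)..T, ∫ s in (0 : ℝ)..T, hatR h₁ (t - s) * hatR h₂ (s - t))
    - ((2 * π * ∫ x : ℝ, h₁ x * h₂ x : ℝ) : ℂ)‖

section helpers

open scoped FourierTransform Convolution

theorem parseval_aux {h₁ h₂ : ℝ → ℂ} {p q : ℝ≥0∞} [ENNReal.HolderConjugate p q]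
    (hp1 : 1 ≤ p) (hq1 : 1 ≤ q) (hq : q ≠ ∞)
    (hi₁ : Integrable h₁) (hi₂ : Integrable h₂) (hm₁ : MemLp h₁ p) (hm₂ : MemLp h₂ q)
    (hF : Integrable (fun ξ => 𝓕 h₁ ξ * 𝓕 h₂ ξ)) :
    ∫ ξ, 𝓕 h₁ ξ * 𝓕 h₂ ξ = ∫ y, h₁ y * h₂ (-y) := by
  have : Fact (1 ≤ p) := ⟨hp1⟩
  have : Fact (1 ≤ q) := ⟨hq1⟩
  have : Fact (q ≠ ∞) := ⟨hq⟩
  set f : ℝ → ℂ := h₁ ⋆[ContinuousLinearMap.mul ℂ ℂ] h₂ with hf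
  have hfour : 𝓕 f = fun ξ => 𝓕 h₁ ξ * 𝓕 h₂ ξ := by
    ext ξ; exact Real.fourier_mul_convolution_eq hi₁ hi₂ ξ
  have hfi : Integrable f := hi₁.integrable_convolution _ hi₂
  have hk : MemLp (fun y => h₂ (-y)) q := hm₂.comp_measurePreserving (Measure.measurePreserving_neg volume)
  have hcont : Continuous f := by
    have h1 : Continuous (fun x : ℝ => (DomAddAct.mk (-x)) +ᵥ hk.toLp _) := by
      fun_prop
    have h2 := ((ContinuousLinearMap.mul ℂ ℂ).lpPairing volume p q (hm₁.toLp _)).continuous.comp h1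
    convert h2 using 1
    ext x
    simp only [Function.comp, DomAddAct.mk_vadd_toLp, ContinuousLinearMap.lpPairing_eq_integral]
    rw [hf, convolution_def]
    apply integral_congr_ae
    filter_upwards [hm₁.coeFn_toLp, MemLp.coeFn_toLp (hk.comp_measurePreserving <| measurePreserving_vadd (-x) volume)] with t ht1 ht2
    refine (congrArg₂ (fun a b => (ContinuousLinearMap.mul ℂ ℂ) a b) ht1.symm (Eq.trans ?_ ht2.symm))
    simp
    congr 1; ring
  have key := hfi.fourierInv_fourier_eq (by rw [hfour]; exact hF) (v := 0) hcont.continuousAt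
  rw [hfour, Real.fourierInv_eq] at key
  simpa [hf, convolution_def] using key

theorem memLp_aux {h : ℝ → ℝ} {σ δ C : ℝ} (hδ : 1 < δ) (hC : 0 < C)
    (hmeas : Measurable h) 
    (hb₁ : ∀ x : ℝ, x ≠ 0 → |x| ≤ 1 → |h x| ≤ C * |x| ^ (-σ))
    (hb₃ : ∀ x : ℝ, 1 < |x| → |h x| ≤ C * |x| ^ (-δ)) {p : ℝ} (hp : 1 ≤ p) (hσp : σ * p < 1) :
    MemLp h (ENNReal.ofReal p) := by
  have hp0 : 0 < p := by linarith
  rw [← integrable_norm_rpow_iff hmeas.aestronglyMeasurable (by simpa using hp0) (by simp),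
    ENNReal.toReal_ofReal hp0.le]
  set B : ℝ → ℝ := fun x => if x ≤ 1 then C ^ p * x ^ (-(σ * p)) else C ^ p * x ^ (-(δ * p)) with hB
  have hBi : IntegrableOn B (Ioi 0) := by
    rw [← Ioc_union_Ioi_eq_Ioi (zero_le_one' ℝ)]
    apply IntegrableOn.union
    · have : IntegrableOn (fun x : ℝ => C ^ p * x ^ (-(σ * p))) (Ioc 0 1) :=
        ((intervalIntegrable_iff_integrableOn_Ioc_of_le zero_le_one).1
          (intervalIntegral.intervalIntegrable_rpow' (by linarith))).const_mul _
      refine this.congr_fun (fun x hx => ?_) measurableSet_Ioc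
      simp [hB, hx.2]
    · have : IntegrableOn (fun x : ℝ => C ^ p * x ^ (-(δ * p))) (Ioi 1) :=
        (integrableOn_Ioi_rpow_of_lt (by nlinarith) one_pos).const_mul _
      refine this.congr_fun (fun x hx => ?_) measurableSet_Ioi
      simp [hB, not_le.2 (mem_Ioi.1 hx)]
  have hBa : Integrable (fun x : ℝ => B |x|) := by
    rw [← integrableOn_univ, ← Iic_union_Ioi (a := (0:ℝ))]
    apply IntegrableOn.union
    · have h1 : IntegrableOn (fun x : ℝ => B (-x)) (Iic 0) := by
        have := ((integrableOn_Ici_iff_integrableOn_Ioi (b := (0:ℝ))).2 hBi).comp_neg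
        simpa using this
      refine h1.congr_fun (fun x hx => ?_) measurableSet_Iic
      simp [abs_of_nonpos (mem_Iic.1 hx)]
    · refine hBi.congr_fun (fun x hx => ?_) measurableSet_Ioi
      simp [abs_of_pos (mem_Ioi.1 hx)]
  refine hBa.mono' (hmeas.norm.pow_const p).aestronglyMeasurable ?_
  have : ∀ᵐ x : ℝ, x ≠ 0 := by simp [ae_iff]
  filter_upwards [this] with x hx
  have hx0 : 0 < |x| := abs_pos.2 hx
  rw [Real.norm_of_nonneg (by positivity), Real.norm_eq_abs]
  by_cases h1 : |x| ≤ 1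
  · simp only [hB, h1, if_true]
    calc |h x| ^ p ≤ (C * |x| ^ (-σ)) ^ p := by gcongr; exact hb₁ x hx h1
      _ = _ := by rw [Real.mul_rpow hC.le (by positivity), ← Real.rpow_mul hx0.le]; ring_nf
  · simp only [hB, h1, if_false]
    calc |h x| ^ p ≤ (C * |x| ^ (-δ)) ^ p := by gcongr; exact hb₃ x (not_le.1 h1)
      _ = _ := by rw [Real.mul_rpow hC.le (by positivity), ← Real.rpow_mul hx0.le]; ring_nf

theorem decay_half {h : ℝ → ℝ} {σ C : ℝ} (hσ : 0 < σ) (hσ1 : σ < 1) (hC : 0 < C)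
    (hh_int : Integrable h)
    (hdiff : ∀ x : ℝ, x ≠ 0 → DifferentiableAt ℝ h x)
    (hb : ∀ x : ℝ, 0 < x → |h x| ≤ C * x ^ (-σ))
    (hb' : ∀ x : ℝ, 0 < x → |deriv h x| ≤ C * x ^ (-σ - 1)) (t : ℝ) (ht : t ≠ 0) :
    ‖∫ x in Ioi (0:ℝ), Complex.exp (Complex.I * x * t) * (h x)‖
      ≤ C * (1 / (1 - σ) + 1 + 1 / σ) * |t| ^ (σ - 1) := by
  have ht0 : 0 < |t| := abs_pos.2 ht
  set a : ℝ := |t|⁻¹ with ha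
  have ha0 : 0 < a := by positivity
  have hnexp : ∀ x : ℝ, ‖Complex.exp (Complex.I * x * t)‖ = 1 := by
    intro x
    rw [show Complex.I * x * t = ((x * t : ℝ) : ℂ) * Complex.I by push_cast; ring]
    exact Complex.norm_exp_ofReal_mul_I _
  have hInt : Integrable (fun x : ℝ => Complex.exp (Complex.I * x * t) * (h x)) := by
    refine (hh_int.ofReal (𝕜 := ℂ)).bdd_mul (c := 1) (by fun_prop) ?_
    filter_upwards with x
    rw [hnexp]
  have hItc : (1:ℂ) * (Complex.I * t) ≠ 0 := by simp [ht]
  rw [← Ioc_union_Ioi_eq_Ioi ha0.le, setIntegral_union (by simp) measurableSet_Ioi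
    hInt.integrableOn hInt.integrableOn]
  have h1 : ‖∫ x in Ioc (0:ℝ) a, Complex.exp (Complex.I * x * t) * (h x)‖
      ≤ C * (1 / (1 - σ)) * |t| ^ (σ - 1) := by
    have hi : IntegrableOn (fun x : ℝ => C * x ^ (-σ)) (Ioc 0 a) :=
        ((intervalIntegrable_iff_integrableOn_Ioc_of_le ha0.le).1
          (intervalIntegral.intervalIntegrable_rpow' (by linarith))).const_mul _
    calc _ ≤ ∫ x in Ioc (0:ℝ) a, C * x ^ (-σ) := by
          apply norm_integral_le_of_norm_le hi
          filter_upwards [ae_restrict_mem measurableSet_Ioc] with x hx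
          rw [norm_mul, hnexp, one_mul, Complex.norm_real]
          exact hb x hx.1
      _ = _ := by
          rw [← intervalIntegral.integral_of_le ha0.le, intervalIntegral.integral_const_mul,
            integral_rpow (Or.inl (by linarith)), Real.zero_rpow (by linarith), ha,
            Real.inv_rpow ht0.le, ← Real.rpow_neg ht0.le]
          rw [show -(-σ + 1) = σ - 1 by ring, show -σ + 1 = 1 - σ by ring]
          ring
  have hpow : |t|⁻¹ * a ^ (-σ) = |t| ^ (σ - 1) := by
    rw [ha, Real.inv_rpow ht0.le, ← Real.rpow_neg ht0.le, neg_neg, Real.rpow_sub ht0,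
      Real.rpow_one]
    field_simp
  have hdi : IntegrableOn (fun x : ℝ => C * x ^ (-σ - 1)) (Ioi a) :=
    (integrableOn_Ioi_rpow_of_lt (by linarith) ha0).const_mul _
  set v : ℝ → ℂ := fun x => Complex.exp (Complex.I * x * t) / (Complex.I * t) with hv
  have hnv : ∀ x, ‖v x‖ = |t|⁻¹ := by
    intro x; simp [hv, hnexp]
  have hdv : ∀ x : ℝ, HasDerivAt v (Complex.exp (Complex.I * x * t)) x := by
    intro x
    have h0 : HasDerivAt (fun x : ℝ => Complex.I * x * t) (Complex.I * t) x := by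
      simpa using ((Complex.ofRealCLM.hasDerivAt (x := x)).const_mul Complex.I).mul_const (t : ℂ)
    have := h0.cexp.div_const (Complex.I * t)
    rw [mul_div_assoc, div_self (by simpa using hItc), mul_one] at this
    exact this
  have hvc : Continuous v := by fun_prop
  have hdvi : IntegrableOn (fun x => ((deriv h x : ℝ) : ℂ) * v x) (Ioi a) := by
    refine (hdi.mul_const |t|⁻¹).mono' ?_ ?_
    · exact ((Complex.measurable_ofReal.comp (measurable_deriv h)).mul
        hvc.measurable).aestronglyMeasurable
    · filter_upwards [ae_restrict_mem measurableSet_Ioi] with x hx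
      rw [norm_mul, hnv, Complex.norm_real, Real.norm_eq_abs]
      gcongr
      exact hb' x (ha0.trans hx)
  have hhc : ContinuousAt (fun x : ℝ => ((h x : ℝ) : ℂ)) a :=
    Complex.continuous_ofReal.continuousAt.comp (hdiff a ha0.ne').continuousAt
  have hIBP := integral_Ioi_mul_deriv_eq_deriv_mul (a := a) (u := fun x => ((h x : ℝ) : ℂ)) (v := v)
    (u' := fun x => ((deriv h x : ℝ) : ℂ)) (v' := fun x => Complex.exp (Complex.I * x * t))
    (a' := h a * v a) (b' := 0)
    (fun x hx => (hdiff x (ha0.trans hx).ne').hasDerivAt.ofReal_comp)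
    (fun x _ => hdv x)
    (by
      have := hInt.integrableOn (s := Ioi a)
      refine this.congr_fun (fun x _ => ?_) measurableSet_Ioi
      simp [mul_comm])
    hdvi
    ((hhc.mul hvc.continuousAt).tendsto.mono_left nhdsWithin_le_nhds)
    (by
      have h0 : Tendsto (fun x : ℝ => C * x ^ (-σ) * |t|⁻¹) atTop (𝓝 0) := by
        simpa using ((tendsto_rpow_neg_atTop hσ).const_mul C).mul_const |t|⁻¹
      refine squeeze_zero_norm' ?_ h0
      filter_upwards [eventually_gt_atTop 0] with x hx
      rw [Pi.mul_apply, norm_mul, hnv, Complex.norm_real, Real.norm_eq_abs]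
      gcongr
      exact hb x hx)
  have h2 : ‖∫ x in Ioi a, Complex.exp (Complex.I * x * t) * (h x)‖
      ≤ C * (1 + 1 / σ) * |t| ^ (σ - 1) := by
    simp_rw [mul_comm (Complex.exp _)]
    rw [hIBP, zero_sub]
    have e1 : ‖(h a : ℂ) * v a‖ ≤ C * |t| ^ (σ - 1) := by
      rw [norm_mul, hnv, Complex.norm_real, Real.norm_eq_abs, ← hpow]
      calc |h a| * |t|⁻¹ ≤ (C * a ^ (-σ)) * |t|⁻¹ := by gcongr; exact hb a ha0
        _ = _ := by ring
    have e2 : ‖∫ x in Ioi a, ((deriv h x : ℝ) : ℂ) * v x‖ ≤ C * (1 / σ) * |t| ^ (σ - 1) := by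
      calc _ ≤ ∫ x in Ioi a, C * x ^ (-σ - 1) * |t|⁻¹ := by
            apply norm_integral_le_of_norm_le (hdi.mul_const |t|⁻¹)
            filter_upwards [ae_restrict_mem measurableSet_Ioi] with x hx
            rw [norm_mul, hnv, Complex.norm_real, Real.norm_eq_abs]
            gcongr
            exact hb' x (ha0.trans hx)
        _ = _ := by
            rw [integral_mul_const, integral_const_mul, integral_Ioi_rpow_of_lt (by linarith) ha0,
              ← hpow, show -σ - 1 + 1 = -σ by ring]
            field_simp
    calc _ ≤ _ := norm_sub_le _ _
      _ ≤ C * |t| ^ (σ - 1) + C * (1 / σ) * |t| ^ (σ - 1) := by rw [norm_neg]; gcongr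
      _ = _ := by ring
  calc _ ≤ _ := norm_add_le _ _
    _ ≤ _ := add_le_add h1 h2
    _ = _ := by ring


theorem hatR_decay {h : ℝ → ℝ} {σ C : ℝ} (hσ : 0 < σ) (hσ1 : σ < 1) (hC : 0 < C)
    (heven : ∀ x, h (-x) = h x)
    (hh_int : Integrable h)
    (hdiff : ∀ x : ℝ, x ≠ 0 → DifferentiableAt ℝ h x)
    (hb : ∀ x : ℝ, 0 < x → |h x| ≤ C * x ^ (-σ))
    (hb' : ∀ x : ℝ, 0 < x → |deriv h x| ≤ C * x ^ (-σ - 1)) :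
    ∃ K : ℝ, 0 < K ∧ ∀ t : ℝ, t ≠ 0 → ‖hatR h t‖ ≤ K * |t| ^ (σ - 1) := by
  have hs : 0 < 1 - σ := by linarith
  refine ⟨2 * (C * (1 / (1 - σ) + 1 + 1 / σ)), by positivity, fun t ht => ?_⟩
  have hInt : Integrable (fun x : ℝ => Complex.exp (Complex.I * x * t) * (h x)) := by
    refine (hh_int.ofReal (𝕜 := ℂ)).bdd_mul (c := 1) (by fun_prop) ?_
    filter_upwards with x
    rw [show Complex.I * x * t = ((x * t : ℝ) : ℂ) * Complex.I by push_cast; ring]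
    exact (Complex.norm_exp_ofReal_mul_I _).le
  have e : hatR h t = (∫ x in Ioi (0:ℝ), Complex.exp (Complex.I * x * (-t : ℝ)) * (h x))
      + ∫ x in Ioi (0:ℝ), Complex.exp (Complex.I * x * t) * (h x) := by
    rw [hatR, ← integral_add_compl (measurableSet_Iic (a := (0:ℝ))) hInt, compl_Iic]
    congr 1
    have := integral_comp_neg_Ioi (0:ℝ) (fun x : ℝ => Complex.exp (Complex.I * x * t) * (h x))
    rw [neg_zero] at this
    rw [← this]
    simp [heven]
  rw [e]
  have a1 := decay_half hσ hσ1 hC hh_int hdiff hb hb' t ht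
  have a2 := decay_half hσ hσ1 hC hh_int hdiff hb hb' (-t) (neg_ne_zero.2 ht)
  rw [abs_neg] at a2
  calc _ ≤ _ := norm_add_le _ _
    _ ≤ _ := add_le_add a2 a1
    _ = _ := by ring

theorem hatR_eq_fourier (h : ℝ → ℝ) (t : ℝ) :
    hatR h t = 𝓕 (fun x => (h x : ℂ)) (-(2 * π)⁻¹ * t) := by
  rw [hatR, Real.fourier_eq']
  congr 1
  ext x
  rw [smul_eq_mul]
  congr 2
  have : (π : ℂ) ≠ 0 := by exact_mod_cast pi_ne_zero
  simp
  field_simp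

theorem hatR_continuous {h : ℝ → ℝ} (hh_int : Integrable h) : Continuous (hatR h) := by
  have h2 : ∀ t x : ℝ, ‖Complex.exp (Complex.I * x * t)‖ = 1 := by
    intro t x
    rw [show Complex.I * x * t = ((x * t : ℝ) : ℂ) * Complex.I by push_cast; ring]
    exact Complex.norm_exp_ofReal_mul_I _
  refine continuous_of_dominated (bound := fun x => ‖h x‖) ?_ ?_ hh_int.norm ?_
  · intro t
    exact (by fun_prop : Continuous fun x : ℝ => Complex.exp (Complex.I * x * t)).aestronglyMeasurable.mul
      (hh_int.ofReal (𝕜 := ℂ)).aestronglyMeasurable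
  · intro t
    filter_upwards with x
    rw [norm_mul, h2, one_mul, Complex.norm_real]
  · filter_upwards with x
    fun_prop

theorem hatR_even {h : ℝ → ℝ} (heven : ∀ x, h (-x) = h x) (t : ℝ) : hatR h (-t) = hatR h t := by
  unfold hatR
  rw [← integral_neg_eq_self]
  simp [heven]

theorem tail_integrable {g : ℝ → ℂ} {K s : ℝ} (hs1 : s < 1) (hgc : Continuous g)
    (hg : ∀ u : ℝ, u ≠ 0 → ‖g u‖ ≤ K * |u| ^ (s - 2)) : Integrable g := by
  have key : ∀ g : ℝ → ℂ, Continuous g → (∀ u : ℝ, u ≠ 0 → ‖g u‖ ≤ K * |u| ^ (s - 2)) →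
      IntegrableOn g (Ici 0) := by
    intro g hgc hg
    rw [← Icc_union_Ici_eq_Ici (zero_le_one' ℝ)]
    refine IntegrableOn.union (hgc.integrableOn_Icc) ?_
    rw [integrableOn_Ici_iff_integrableOn_Ioi]
    refine ((integrableOn_Ioi_rpow_of_lt (a := s - 2) (by linarith) one_pos).const_mul K).mono'
      hgc.aestronglyMeasurable ?_
    filter_upwards [ae_restrict_mem measurableSet_Ioi] with x hx
    have hx0 : 0 < x := one_pos.trans hx
    simpa [abs_of_pos hx0] using hg x hx0.ne'
  rw [← integrableOn_univ, ← Iic_union_Ici (a := (0:ℝ))]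
  refine IntegrableOn.union ?_ (key g hgc hg)
  have := (key (fun x => g (-x)) (by fun_prop) (fun u hu => by
    simpa using hg (-u) (neg_ne_zero.2 hu))).comp_neg
  simpa using this

theorem tail_bound {g : ℝ → ℂ} {K s : ℝ} (hs1 : s < 1)
    (hg : ∀ u : ℝ, u ≠ 0 → ‖g u‖ ≤ K * |u| ^ (s - 2)) (t : ℝ) (ht : 0 < t) :
    ‖∫ u in Ioi t, g u‖ ≤ K / (1 - s) * t ^ (s - 1) := by
  calc _ ≤ ∫ u in Ioi t, K * u ^ (s - 2) := by
        apply norm_integral_le_of_norm_le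
          ((integrableOn_Ioi_rpow_of_lt (a := s - 2) (by linarith) ht).const_mul K)
        filter_upwards [ae_restrict_mem measurableSet_Ioi] with x hx
        have hx0 : 0 < x := ht.trans hx
        simpa [abs_of_pos hx0] using hg x hx0.ne'
    _ = _ := by
        rw [integral_const_mul, integral_Ioi_rpow_of_lt (by linarith) ht,
          show s - 2 + 1 = -(1 - s) by ring, show s - 1 = -(1 - s) by ring]
        have : 1 - s ≠ 0 := by linarith
        field_simp

theorem toeplitz_bound {g : ℝ → ℂ} {K s : ℝ} (hs : 0 < s) (hs1 : s < 1) (hgc : Continuous g)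
    (hg : ∀ u : ℝ, u ≠ 0 → ‖g u‖ ≤ K * |u| ^ (s - 2)) (T : ℝ) (hT : 0 < T) :
    ‖(T : ℂ)⁻¹ * (∫ t in (0 : ℝ)..T, ∫ s in (0 : ℝ)..T, g (t - s)) - ∫ u, g u‖
      ≤ 2 * (K / (1 - s)) / s * T ^ (s - 1) := by
  have hgi := tail_integrable hs1 hgc hg
  have hTc : (T : ℂ) ≠ 0 := by exact_mod_cast hT.ne'
  set I := ∫ u, g u with hI
  have hcont : Continuous (fun t : ℝ => ∫ s in (0 : ℝ)..T, g (t - s)) := by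
    apply intervalIntegral.continuous_parametric_intervalIntegral_of_continuous'
    fun_prop
  have e1 : (T : ℂ)⁻¹ * (∫ t in (0 : ℝ)..T, ∫ s in (0 : ℝ)..T, g (t - s)) - I
      = (T : ℂ)⁻¹ * ∫ t in (0 : ℝ)..T, ((∫ s in (0 : ℝ)..T, g (t - s)) - I) := by
    rw [intervalIntegral.integral_sub (hcont.intervalIntegrable _ _) (by simp)]
    simp
    field_simp
  have hpt : ∀ t ∈ Ioo 0 T, ‖(∫ s in (0 : ℝ)..T, g (t - s)) - I‖
      ≤ K / (1 - s) * (t ^ (s - 1) + (T - t) ^ (s - 1)) := by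
    intro t ht
    have h1 : I = (∫ u in Iic (t - T), g u) + (∫ u in (t - T)..t, g u) + ∫ u in Ioi t, g u := by
      rw [hI, intervalIntegral.integral_of_le (by linarith),
        ← setIntegral_union (by simp) measurableSet_Ioc hgi.integrableOn hgi.integrableOn,
        Iic_union_Ioc_eq_Iic (by linarith), ← compl_Iic,
        integral_add_compl measurableSet_Iic hgi]
    have h2 : (∫ s in (0 : ℝ)..T, g (t - s)) = ∫ u in (t - T)..t, g u := by simp
    have h3 : (∫ u in Iic (t - T), g u) = ∫ u in Ioi (T - t), g (-u) := by
      rw [integral_comp_neg_Ioi]; simp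
    rw [h2, h1, h3]
    have b1 := tail_bound hs1 hg t ht.1
    have b2 := tail_bound (g := fun u => g (-u)) hs1 (fun u hu => by
      simpa using hg (-u) (neg_ne_zero.2 hu)) (T - t) (by linarith [ht.2])
    rw [show ∀ a b c : ℂ, b - (a + b + c) = -(a + c) by intros; ring, norm_neg]
    calc _ ≤ _ := norm_add_le _ _
      _ ≤ _ := add_le_add b2 b1
      _ = _ := by ring
  have i1 : IntervalIntegrable (fun t : ℝ => t ^ (s - 1)) volume 0 T :=
    intervalIntegral.intervalIntegrable_rpow' (by linarith)
  have i2 : IntervalIntegrable (fun t : ℝ => (T - t) ^ (s - 1)) volume 0 T := by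
    simpa using (i1.comp_sub_left T).symm
  have v1 : ∫ t in (0:ℝ)..T, t ^ (s - 1) = T ^ s / s := by
    rw [integral_rpow (Or.inl (by linarith))]
    simp [Real.zero_rpow hs.ne']
  have v2 : ∫ t in (0:ℝ)..T, (T - t) ^ (s - 1) = T ^ s / s := by
    rw [← v1, intervalIntegral.integral_comp_sub_left (fun t : ℝ => t ^ (s - 1))]; simp
  have e2 : ‖∫ t in (0 : ℝ)..T, ((∫ s in (0 : ℝ)..T, g (t - s)) - I)‖
      ≤ ∫ t in (0 : ℝ)..T, K / (1 - s) * (t ^ (s - 1) + (T - t) ^ (s - 1)) := by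
    apply intervalIntegral.norm_integral_le_of_norm_le hT.le
    · have : ∀ᵐ x : ℝ, x ≠ T := by simp [ae_iff]
      filter_upwards [this] with x hx hx'
      exact hpt x ⟨hx'.1, lt_of_le_of_ne hx'.2 hx⟩
    · exact (i1.add i2).const_mul _
  rw [intervalIntegral.integral_const_mul, intervalIntegral.integral_add i1 i2, v1, v2] at e2
  rw [e1, norm_mul, norm_inv, Complex.norm_real, Real.norm_of_nonneg hT.le]
  calc _ ≤ T⁻¹ * (K / (1 - s) * (T ^ s / s + T ^ s / s)) := by gcongr
    _ = _ := by rw [Real.rpow_sub_one hT.ne']; field_simp; ring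

end helpers

open scoped FourierTransform

theorem stmt15 (h : Fin 2 → ℝ → ℝ)
    (heven : ∀ i, ∀ x : ℝ, h i (-x) = h i x)
    (σ δ C : Fin 2 → ℝ)
    (hσ : ∀ i, 0 < σ i) (hδ : ∀ i, 1 < δ i) (hC : ∀ i, 0 < C i)
    (hσsum : σ 0 + σ 1 < 1)
    (hdiff : ∀ i, ∀ x : ℝ, x ≠ 0 → DifferentiableAt ℝ (h i) x)
    (hb₁ : ∀ i, ∀ x : ℝ, x ≠ 0 → |x| ≤ 1 → |h i x| ≤ C i * |x| ^ (-(σ i)))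
    (hb₂ : ∀ i, ∀ x : ℝ, x ≠ 0 → |x| ≤ 1 →
      |deriv (h i) x| ≤ C i * |x| ^ (-(σ i) - 1))
    (hb₃ : ∀ i, ∀ x : ℝ, 1 < |x| → |h i x| ≤ C i * |x| ^ (-(δ i)))
    (hb₄ : ∀ i, ∀ x : ℝ, 1 < |x| →
      |deriv (h i) x| ≤ C i * |x| ^ (-(δ i) - 1)) :
    (fun T : ℝ => Δ₂W (h 0) (h 1) T) =O[atTop]
      fun T : ℝ => T ^ (-1 + (σ 0 + σ 1)) := by
  have hσ1 : ∀ i, σ i < 1 := by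
    intro i
    have h0 := hσ 0
    have h1 := hσ 1
    fin_cases i <;> simp <;> linarith
  have hmeas : ∀ i, Measurable (h i) := fun i =>
    measurable_of_continuousOn_compl_singleton 0
      (fun x hx => (hdiff i x hx).continuousAt.continuousWithinAt)
  have hb : ∀ i, ∀ x : ℝ, 0 < x → |h i x| ≤ C i * x ^ (-(σ i)) := by
    intro i x hx
    rcases le_or_gt x 1 with h1 | h1
    · simpa [abs_of_pos hx] using hb₁ i x hx.ne' (by rwa [abs_of_pos hx])
    · have := hb₃ i x (by rwa [abs_of_pos hx])
      rw [abs_of_pos hx] at this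
      refine this.trans (mul_le_mul_of_nonneg_left ?_ (hC i).le)
      exact Real.rpow_le_rpow_of_exponent_le h1.le (by linarith [hσ1 i, hδ i])
  have hb' : ∀ i, ∀ x : ℝ, 0 < x → |deriv (h i) x| ≤ C i * x ^ (-(σ i) - 1) := by
    intro i x hx
    rcases le_or_gt x 1 with h1 | h1
    · simpa [abs_of_pos hx] using hb₂ i x hx.ne' (by rwa [abs_of_pos hx])
    · have := hb₄ i x (by rwa [abs_of_pos hx])
      rw [abs_of_pos hx] at this
      refine this.trans (mul_le_mul_of_nonneg_left ?_ (hC i).le)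
      exact Real.rpow_le_rpow_of_exponent_le h1.le (by linarith [hσ1 i, hδ i])
  have hmem : ∀ i, ∀ p : ℝ, 1 ≤ p → σ i * p < 1 → MemLp (h i) (ENNReal.ofReal p) :=
    fun i p hp hpσ => memLp_aux (hδ i) (hC i) (hmeas i) (hb₁ i) (hb₃ i) hp hpσ
  have hh_int : ∀ i, Integrable (h i) := by
    intro i
    rw [← memLp_one_iff_integrable]
    simpa using hmem i 1 le_rfl (by simpa using hσ1 i)
  have hdec := fun i => hatR_decay (hσ i) (hσ1 i) (hC i) (heven i) (hh_int i) (hdiff i) (hb i) (hb' i)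
  choose K hK0 hK using hdec
  set g : ℝ → ℂ := fun u => hatR (h 0) u * hatR (h 1) u with hgdef
  have hgc : Continuous g := (hatR_continuous (hh_int 0)).mul (hatR_continuous (hh_int 1))
  set s : ℝ := σ 0 + σ 1 with hsdef
  have hs : 0 < s := add_pos (hσ 0) (hσ 1)
  have hg : ∀ u : ℝ, u ≠ 0 → ‖g u‖ ≤ (K 0 * K 1) * |u| ^ (s - 2) := by
    intro u hu
    have hu0 : 0 < |u| := abs_pos.2 hu
    have hk0 := hK0 0
    calc ‖g u‖ = ‖hatR (h 0) u‖ * ‖hatR (h 1) u‖ := norm_mul _ _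
      _ ≤ (K 0 * |u| ^ (σ 0 - 1)) * (K 1 * |u| ^ (σ 1 - 1)) :=
          mul_le_mul (hK 0 u hu) (hK 1 u hu) (norm_nonneg _) (by positivity)
      _ = (K 0 * K 1) * (|u| ^ (σ 0 - 1) * |u| ^ (σ 1 - 1)) := by ring
      _ = _ := by
          rw [← Real.rpow_add hu0]
          congr 2
          rw [hsdef]; ring
  have hgi : Integrable g := tail_integrable hσsum hgc hg
  have hpi : (-(2 * π)⁻¹ : ℝ) ≠ 0 := by simp [pi_ne_zero]
  set f : Fin 2 → ℝ → ℂ := fun i x => (h i x : ℂ) with hfdef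
  have hgF : g = fun u => (fun ξ => 𝓕 (f 0) ξ * 𝓕 (f 1) ξ) (-(2 * π)⁻¹ * u) := by
    ext u
    simp only [hgdef, hatR_eq_fourier, hfdef]
  have hF : Integrable (fun ξ => 𝓕 (f 0) ξ * 𝓕 (f 1) ξ) := by
    rw [hgF] at hgi
    exact (integrable_comp_mul_left_iff _ hpi).1 hgi
  have hpars : ∫ u, g u = ((2 * π * ∫ x : ℝ, h 0 x * h 1 x : ℝ) : ℂ) := by
    set a : ℝ := σ 0 + (1 - s) / 2 with ha
    have ha0 : 0 < a := by have := hσ 0; rw [ha]; linarith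
    have hσ00 := hσ 0
    have hσ10 := hσ 1
    have ha1' : 0 < 1 - a := by linarith
    have hconj : Real.HolderConjugate a⁻¹ (1 - a)⁻¹ := by
      rw [Real.holderConjugate_iff]
      refine ⟨(one_lt_inv₀ ha0).2 (by linarith), by simp⟩
    have : ENNReal.HolderConjugate (ENNReal.ofReal a⁻¹) (ENNReal.ofReal (1 - a)⁻¹) :=
      hconj.ennrealOfReal
    have hP := parseval_aux (h₁ := f 0) (h₂ := f 1) (p := ENNReal.ofReal a⁻¹)
      (q := ENNReal.ofReal (1 - a)⁻¹)
      (by simpa using hconj.lt.le) (by simpa using hconj.symm.lt.le) (by simp)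
      (hh_int 0).ofReal (hh_int 1).ofReal
      ((hmem 0 _ hconj.lt.le (by rw [← div_eq_mul_inv, div_lt_one ha0]; linarith)).ofReal)
      ((hmem 1 _ hconj.symm.lt.le
        (by rw [← div_eq_mul_inv, div_lt_one ha1']; linarith)).ofReal) hF
    rw [hgF, Measure.integral_comp_mul_left, hP]
    simp only [hfdef, heven]
    rw [show (∫ y, (h 0 y : ℂ) * (h 1 y : ℂ)) = ((∫ y, h 0 y * h 1 y : ℝ) : ℂ) by
      rw [← integral_complex_ofReal]; simp]
    simp [abs_of_pos pi_pos]
  refine IsBigO.of_bound (2 * (K 0 * K 1 / (1 - s)) / s) ?_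
  filter_upwards [eventually_gt_atTop 0] with T hT
  have hB := toeplitz_bound hs hσsum hgc hg T hT
  rw [Δ₂W, Real.norm_of_nonneg (norm_nonneg _), Real.norm_of_nonneg (by positivity), ← hpars,
    show -1 + s = s - 1 by ring]
  have e : ∀ t r : ℝ, hatR (h 0) (t - r) * hatR (h 1) (r - t) = g (t - r) := by
    intro t r
    rw [hgdef, ← neg_sub t r, hatR_even (heven 1)]
  simp only [e]
  exact hB
end
end
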